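/- Let $m\geq3$, $q\geq4$, $1\leq t\leq m-2$, $2\leq s\leq q-2$. If $f\in R_q(t(q-1)+s,m)$ satisfies $|f|=(q-1)(q-s+1)q^{m-t-2}$, then the support of $f$ is contained in an affine subspace of codimension $t$ of $\mathbb{F}_q^m$. -/

import Mathlib

/-- Membership in the generalized Reed–Muller code `R_q(r,m)`: `f` is represented by a
polynomial of total degree at most `r` (equivalently, its reduced form has degree ≤ r). -/
def RM (F : Type) [Field F] (r m : ℕ) (f : (Fin m → F) → F) : Prop :=
  ∃ P : MvPolynomial (Fin m) F, P.totalDegree ≤ r ∧ ∀ x, MvPolynomial.eval x P = f x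

/-- Hamming weight: the size of the support of `f`. -/
def wt {F : Type} [Field F] [Fintype F] [DecidableEq F] {m : ℕ} (f : (Fin m → F) → F) : ℕ :=
  (Finset.univ.filter fun x => f x ≠ 0).card

section Aux
open Finset

variable {F : Type} [Field F] {V W : Type} [AddCommGroup V] [Module F V]
  [AddCommGroup W] [Module F W]

inductive Dg : ℕ → (V → F) → Prop
  | const (r : ℕ) (c : F) : Dg r (fun _ => c)
  | add {r : ℕ} {f g : V → F} : Dg r f → Dg r g → Dg r (fun x => f x + g x)
  | mul {r : ℕ} {f : V → F} (φ : V →ₗ[F] F) : Dg r f → Dg (r + 1) (fun x => φ x * f x)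

theorem Dg.mono {r : ℕ} {f : V → F} (h : Dg r f) : ∀ {r' : ℕ}, r ≤ r' → Dg r' f := by
  induction h with
  | const r c => intro r' _; exact Dg.const _ _
  | add _ _ ih1 ih2 => intro r' h; exact Dg.add (ih1 h) (ih2 h)
  | mul φ _ ih =>
    intro r' h
    obtain ⟨k, rfl⟩ : ∃ k, r' = k + 1 := ⟨r' - 1, by omega⟩
    exact Dg.mul φ (ih (by omega))

theorem Dg.cmul {r : ℕ} {f : V → F} (c : F) (h : Dg r f) : Dg r (fun x => c * f x) := by
  induction h with
  | const r d => exact Dg.const _ _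
  | add _ _ ih1 ih2 =>
    have := Dg.add ih1 ih2
    simpa only [mul_add] using this
  | mul φ _ ih =>
    have := Dg.mul φ ih
    simpa only [mul_left_comm] using this

theorem Dg.mulaff {r : ℕ} {f : V → F} (φ : V →ₗ[F] F) (c : F) (h : Dg r f) :
    Dg (r + 1) (fun x => (φ x - c) * f x) := by
  have := Dg.add (Dg.mul φ h) ((Dg.cmul (-c) h).mono (Nat.le_succ r))
  convert this using 2
  ring

theorem Dg.pull {r : ℕ} {f : V → F} (h : Dg r f) (L : W →ₗ[F] V) (p : V) :
    Dg r (fun w => f (p + L w)) := by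
  induction h with
  | const r d => exact Dg.const _ _
  | add _ _ ih1 ih2 => exact Dg.add ih1 ih2
  | mul φ _ ih =>
    have := Dg.mulaff (φ ∘ₗ L) (-(φ p)) ih
    convert this using 2
    simp [add_comm]

theorem Dg.div {r : ℕ} {f : V → F} (h : Dg r f) (φ : V →ₗ[F] F) (e : V) (a : F) :
    ∃ g : V → F, Dg (r - 1) g ∧ (r = 0 → g = 0) ∧
      ∀ x, f x - f (x - (φ x - a) • e) = (φ x - a) * g x := by
  induction h with
  | const r d => exact ⟨fun _ => 0, Dg.const _ _, fun _ => rfl, by simp⟩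
  | add _ _ ih1 ih2 =>
    obtain ⟨g1, h1, h1', h1''⟩ := ih1
    obtain ⟨g2, h2, h2', h2''⟩ := ih2
    refine ⟨_, Dg.add h1 h2, ?_, ?_⟩
    · intro h; rw [h1' h, h2' h]; ext; simp
    · intro x; rw [mul_add, ← h1'', ← h2'']; ring
  | @mul r f ψ hf ih =>
    obtain ⟨g, h1, h1', h1''⟩ := ih
    have hp := Dg.pull hf (LinearMap.id - φ.smulRight e) (a • e)
    have hp' : Dg r (fun x => f (x - (φ x - a) • e)) := by
      convert hp using 3
      simp [sub_smul]; abel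
    refine ⟨fun x => ψ x * g x + ψ e * f (x - (φ x - a) • e), ?_, by simp, ?_⟩
    · refine Dg.add ?_ (Dg.cmul _ hp')
      rcases Nat.eq_zero_or_pos r with h0 | h0
      · rw [h1' h0]; simpa using Dg.const _ _
      · have := Dg.mul ψ h1
        convert this using 1
        omega
    · intro x
      have := h1'' x
      simp only [map_sub, map_smul, smul_eq_mul]
      linear_combination (ψ x) * this

theorem Dg.divide {r : ℕ} {f : V → F} (h : Dg r f) (φ : V →ₗ[F] F) (hφ : φ ≠ 0) (a : F)
    (h0 : ∀ x, φ x = a → f x = 0) (hne : ∃ x, f x ≠ 0) :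
    ∃ r', r = r' + 1 ∧ ∃ g, Dg r' g ∧ ∀ x, f x = (φ x - a) * g x := by
  obtain ⟨e, he⟩ : ∃ e, φ e = 1 := by
    obtain ⟨v, hv⟩ : ∃ v, φ v ≠ 0 := by
      by_contra! hc
      exact hφ (LinearMap.ext hc)
    exact ⟨(φ v)⁻¹ • v, by simp [hv]⟩
  obtain ⟨g, hg, hg0, hfg⟩ := h.div φ e a
  have key : ∀ x, f x = (φ x - a) * g x := by
    intro x
    rw [← hfg x, h0 (x - (φ x - a) • e) (by simp [he]), sub_zero]
  rcases Nat.eq_zero_or_pos r with hr | hr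
  · obtain ⟨x, hx⟩ := hne
    exact absurd (by rw [key, hg0 hr]; simp) hx
  · exact ⟨r - 1, by omega, g, hg, key⟩

theorem Dg.divides {r : ℕ} {f : V → F} (h : Dg r f) (φ : V →ₗ[F] F) (hφ : φ ≠ 0) (A : Finset F)
    (h0 : ∀ x, φ x ∈ A → f x = 0) (hne : ∃ x, f x ≠ 0) :
    ∃ r', r = r' + A.card ∧ ∃ g, Dg r' g ∧ ∀ x, f x = (∏ a ∈ A, (φ x - a)) * g x := by
  classical
  induction A using Finset.induction_on with
  | empty => exact ⟨r, by simp, f, h, by simp⟩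
  | insert a A ha ih =>
    obtain ⟨r', hr', g, hg, hfg⟩ := ih (fun x hx => h0 x (by simp [hx]))
    obtain ⟨r'', hr'', g', hg', hgg'⟩ := hg.divide φ hφ a (by
      intro x hx
      have h1 := h0 x (by simp [hx])
      rw [hfg] at h1
      rcases mul_eq_zero.1 h1 with h2 | h2
      · obtain ⟨b, hb, hb'⟩ := Finset.prod_eq_zero_iff.1 h2
        rw [hx, sub_eq_zero] at hb'
        exact absurd (hb' ▸ hb) ha
      · exact h2) (by
      obtain ⟨x, hx⟩ := hne
      refine ⟨x, fun hc => hx ?_⟩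
      rw [hfg, hc, mul_zero])
    refine ⟨r'', ?_, g', hg', ?_⟩
    · rw [Finset.card_insert_of_notMem ha]; omega
    · intro x
      rw [Finset.prod_insert ha, hfg, hgg']; ring

theorem Dg.mulprod {r : ℕ} {f : V → F} (h : Dg r f) (φ : V →ₗ[F] F) (A : Finset F) :
    Dg (r + A.card) (fun x => (∏ a ∈ A, (φ x - a)) * f x) := by
  classical
  induction A using Finset.induction_on with
  | empty => simpa using h
  | insert a A ha ih =>
    have := Dg.mulaff φ a ih
    rw [Finset.card_insert_of_notMem ha, ← add_assoc]
    convert this using 2 with x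
    rw [Finset.prod_insert ha]; ring

/-- size of the support -/
noncomputable def Nw (f : V → F) : ℕ := Set.ncard {x | f x ≠ 0}

noncomputable def Ww (f : V → F) (φ : V →ₗ[F] F) (c : F) : ℕ :=
  Set.ncard {x | f x ≠ 0 ∧ φ x = c}

def InHyp (f : V → F) : Prop := ∃ φ : V →ₗ[F] F, φ ≠ 0 ∧ ∃ c, ∀ x, f x ≠ 0 → φ x = c

open Classical in
noncomputable def Em [Fintype F] (f : V → F) (φ : V →ₗ[F] F) : Finset F :=
  Finset.univ.filter (fun c => ∀ x, f x ≠ 0 → φ x ≠ c)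

theorem sum_Ww [Fintype F] [Finite V] (f : V → F) (φ : V →ₗ[F] F) :
    ∑ c, Ww f φ c = Nw f := by
  classical
  have := Fintype.ofFinite V
  unfold Ww Nw
  simp only [Set.ncard_eq_toFinset_card']
  rw [Finset.card_eq_sum_card_fiberwise (f := φ) (t := Finset.univ) (by simp)]
  refine Finset.sum_congr rfl fun c _ => ?_
  congr 1
  ext x; simp

theorem mem_Em [Fintype F] [Finite V] (f : V → F) (φ : V →ₗ[F] F) (c : F) :
    c ∈ Em f φ ↔ Ww f φ c = 0 := by
  simp only [Em, Finset.mem_filter, Finset.mem_univ, true_and, Ww]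
  rw [Set.ncard_eq_zero]
  simp only [Set.eq_empty_iff_forall_notMem, Set.mem_ofPred_eq, not_and]

theorem not_mem_Em [Fintype F] (f : V → F) (φ : V →ₗ[F] F) (c : F) :
    c ∉ Em f φ ↔ ∃ x, f x ≠ 0 ∧ φ x = c := by
  simp [Em]

theorem finrank_ker1 [Finite V] (φ : V →ₗ[F] F) (hφ : φ ≠ 0) :
    Module.finrank F (LinearMap.ker φ) + 1 = Module.finrank F V := by
  have h := LinearMap.finrank_range_add_finrank_ker φ
  have : LinearMap.range φ = ⊤ := LinearMap.range_eq_top.2 (LinearMap.surjective hφ)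
  rw [this, finrank_top, Module.finrank_self] at h
  omega

theorem slab [Fintype F] [Finite V] {r : ℕ} {f : V → F} (h : Dg r f) (φ : V →ₗ[F] F) (hφ : φ ≠ 0)
    (c : F) (hc : c ∉ Em f φ) :
    ∃ r', r = r' + (Em f φ).card ∧ ∃ g : LinearMap.ker φ → F, Dg r' g ∧ (∃ x, g x ≠ 0) ∧
      Nw g = Ww f φ c ∧ ∃ p, φ p = c ∧ ∀ w, g w ≠ 0 ↔ f (p + w) ≠ 0 := by
  obtain ⟨p, hp, hpc⟩ := (not_mem_Em f φ c).1 hc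
  obtain ⟨r', hr', g, hg, hfg⟩ := h.divides φ hφ (Em f φ) (by
    intro x hx
    by_contra hne
    exact (not_mem_Em f φ (φ x)).2 ⟨x, hne, rfl⟩ hx) ⟨p, hp⟩
  have hiff : ∀ w : LinearMap.ker φ, g (p + w) ≠ 0 ↔ f (p + w) ≠ 0 := by
    intro w
    rw [hfg (p + w)]
    have : ∏ a ∈ Em f φ, (φ (p + w) - a) ≠ 0 := by
      refine Finset.prod_ne_zero_iff.2 fun a ha => ?_
      rw [map_add, hpc, LinearMap.mem_ker.1 w.2, add_zero, sub_ne_zero]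
      rintro rfl; exact hc ha
    rw [mul_ne_zero_iff]
    exact ⟨fun h => ⟨this, h⟩, fun h => h.2⟩
  refine ⟨r', hr', fun w => g (p + w), hg.pull (LinearMap.ker φ).subtype p, ⟨0, ?_⟩, ?_, p, hpc, hiff⟩
  · rw [hiff]; simpa using hp
  · unfold Nw Ww
    refine Set.ncard_congr (fun w _ => p + (w : V)) ?_ ?_ ?_
    · intro w hw
      exact ⟨(hiff w).1 hw, by rw [map_add, hpc, LinearMap.mem_ker.1 w.2, add_zero]⟩
    · intro a b _ _ hab
      exact Subtype.ext (add_left_cancel hab)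
    · intro x hx
      refine ⟨⟨x - p, ?_⟩, ?_, by simp⟩
      · rw [LinearMap.mem_ker, map_sub, hx.2, hpc, sub_self]
      · change g _ ≠ 0
        rw [hiff]; simpa using hx.1

theorem slabHyp {f : V → F} {φ : V →ₗ[F] F} {c : F}
    {g : LinearMap.ker φ → F} {p : V} (hp : φ p = c) (hg : ∀ w, g w ≠ 0 ↔ f (p + w) ≠ 0)
    (hH : InHyp g) :
    ∃ φ0 : V →ₗ[F] F, ∃ c0, (∀ l : F, φ0 + l • φ ≠ 0) ∧ ∀ x, f x ≠ 0 → φ x = c → φ0 x = c0 := by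
  obtain ⟨ψ, hψ, d, hd⟩ := hH
  obtain ⟨φ0, h0⟩ := LinearMap.exists_extend ψ
  refine ⟨φ0, φ0 p + d, ?_, ?_⟩
  · intro l hl
    apply hψ
    ext w
    have h1 : (φ0 + l • φ) (w : V) = 0 := by rw [hl]; rfl
    have h2 : φ (w : V) = 0 := w.2
    rw [← h0]
    simpa [h2] using h1
  · intro x hx hxc
    have hk : x - p ∈ LinearMap.ker φ := by rw [LinearMap.mem_ker, map_sub, hxc, hp, sub_self]
    have := hd ⟨x - p, hk⟩ ((hg _).2 (by simpa using hx))
    rw [← h0] at this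
    simp at this
    rw [← this]; ring

theorem iso [Fintype F] [DecidableEq F] {r : ℕ} {f : V → F} (h : Dg r f) (φ ψ : V →ₗ[F] F) (d : F)
    (B : Finset F) (c1 : F) (hc1 : c1 ∉ Em f φ) (hc1B : c1 ∉ B) (hBE : Disjoint B (Em f φ))
    (hB : ∀ x, f x ≠ 0 → φ x ∈ B → ψ x = d) :
    ∃ j, j + (Em f φ).card + B.card + 1 = Fintype.card F ∧ ∃ g : V → F, Dg (r + 1 + j) g ∧
      ∀ x, g x ≠ 0 ↔ (f x ≠ 0 ∧ φ x = c1 ∧ ψ x ≠ d) := by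
  set U : Finset F := insert c1 (B ∪ Em f φ) with hU
  have hUc : U.card = (Em f φ).card + B.card + 1 := by
    rw [hU, Finset.card_insert_of_notMem (by simp [hc1, hc1B]), Finset.card_union_of_disjoint hBE]
    ring
  refine ⟨Uᶜ.card, ?_, _, (h.mulaff ψ d).mulprod φ Uᶜ, ?_⟩
  · have := Finset.card_compl_add_card U
    omega
  · intro x
    simp only [ne_eq, mul_eq_zero, not_or, Finset.prod_eq_zero_iff, sub_eq_zero, not_exists, not_and]
    constructor
    · rintro ⟨h1, h2, h3⟩
      have hx : φ x ∈ U := by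
        by_contra hx
        exact h1 (φ x) (by simpa using hx) rfl
      simp only [hU, Finset.mem_insert, Finset.mem_union] at hx
      rcases hx with hx | hx | hx
      · exact ⟨h3, hx, h2⟩
      · exact absurd (hB x h3 hx) h2
      · exact absurd hx ((not_mem_Em f φ (φ x)).2 ⟨x, h3, rfl⟩)
    · rintro ⟨h1, h2, h3⟩
      refine ⟨?_, h3, h1⟩
      rintro a ha rfl
      simp [hU, h2] at ha

theorem exists_dual [Finite V] (h : 1 ≤ Module.finrank F V) : ∃ φ : V →ₗ[F] F, φ ≠ 0 := by
  have : Nontrivial V := Module.nontrivial_of_finrank_pos (R := F) (by omega)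
  obtain ⟨v, hv⟩ := exists_ne (0 : V)
  by_contra! hc
  apply hv
  rw [← Module.forall_dual_apply_eq_zero_iff F v]
  intro φ
  rw [hc φ]; rfl

theorem sum_lb [Fintype F] [Finite V] (f : V → F) (φ : V →ₗ[F] F) (v k' : ℕ)
    (hk : k' + (Em f φ).card = Fintype.card F) (h : ∀ c, c ∉ Em f φ → v ≤ Ww f φ c) :
    k' * v ≤ Nw f := by
  classical
  rw [← sum_Ww f φ]
  have h1 : (Em f φ)ᶜ.card = k' := by
    have := Finset.card_compl_add_card (Em f φ); omega
  calc k' * v = ∑ c ∈ (Em f φ)ᶜ, v := by simp [h1]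
    _ ≤ ∑ c ∈ (Em f φ)ᶜ, Ww f φ c := Finset.sum_le_sum fun c hc => h c (by simpa using hc)
    _ ≤ ∑ c, Ww f φ c := Finset.sum_le_sum_of_subset (Finset.subset_univ _)

theorem Ww_pos [Fintype F] [Finite V] (f : V → F) (φ : V →ₗ[F] F) (c : F) (h : c ∉ Em f φ) :
    1 ≤ Ww f φ c := by
  rw [mem_Em] at h; omega

theorem Em_card_lt [Fintype F] (f : V → F) (φ : V →ₗ[F] F) (h : ∃ x, f x ≠ 0) :
    (Em f φ).card < Fintype.card F := by
  obtain ⟨x, hx⟩ := h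
  exact Finset.card_lt_univ_of_notMem ((not_mem_Em f φ (φ x)).2 ⟨x, hx, rfl⟩)

theorem MD [Fintype F] {q : ℕ} (hq : Fintype.card F = q) : ∀ (m : ℕ) (V : Type) [AddCommGroup V]
    [Module F V] [Finite V], Module.finrank F V = m → ∀ (t s e n : ℕ) (f : V → F),
    m = t + 1 + n → s + e = q → 1 ≤ e → Dg (t * (q - 1) + s) f → (∃ x, f x ≠ 0) →
    e * q ^ n ≤ Nw f := by
  intro m
  induction m with
  | zero => intros; omega
  | succ m ih =>
    intro V _ _ _ hV t s e n f hm hse he hf hne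
    obtain ⟨φ, hφ⟩ := exists_dual (F := F) (V := V) (by omega)
    have hker := finrank_ker1 φ hφ
    have hlt := Em_card_lt f φ hne
    obtain ⟨k, hk⟩ : ∃ k, k = (Em f φ).card := ⟨_, rfl⟩
    obtain ⟨k', hk'⟩ : ∃ k', k' + (Em f φ).card = Fintype.card F :=
      ⟨Fintype.card F - (Em f φ).card, by omega⟩
    by_cases hks : k ≤ s
    · obtain ⟨a, rfl⟩ : ∃ a, s = k + a := ⟨s - k, by omega⟩
      have hk'' : k' = a + e := by omega
      cases n with
      | zero =>
        have := sum_lb f φ 1 k' hk' (Ww_pos f φ)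
        simp; omega
      | succ n =>
        have := sum_lb f φ ((e + k) * q ^ n) k' hk' (by
          intro c hc
          obtain ⟨r', hr', g, hg, hgne, hgN, -⟩ := slab hf φ hφ c hc
          rw [← hgN]
          refine ih _ (by omega) t a (e + k) n g (by omega) (by omega) (by omega) ?_ hgne
          convert hg using 1
          omega)
        refine le_trans ?_ this
        rw [hk'', pow_succ, ← hse]
        nlinarith [Nat.zero_le (a * k * (k + a + e) ^ n)]
    · have hcE : ∃ c, c ∉ Em f φ := by
        obtain ⟨x, hx⟩ := hne
        exact ⟨φ x, (not_mem_Em f φ (φ x)).2 ⟨x, hx, rfl⟩⟩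
      have ht : t ≠ 0 := by
        rintro rfl
        obtain ⟨c, hc⟩ := hcE
        obtain ⟨r', hr', -⟩ := slab hf φ hφ c hc
        omega
      obtain ⟨t, rfl⟩ := Nat.exists_eq_succ_of_ne_zero ht
      obtain ⟨b, rfl⟩ : ∃ b, k = s + b := ⟨k - s, by omega⟩
      have := sum_lb f φ ((b + 1) * q ^ n) k' hk' (by
          intro c hc
          obtain ⟨r', hr', g, hg, hgne, hgN, -⟩ := slab hf φ hφ c hc
          rw [← hgN]
          refine ih _ (by omega) t (k' - 1 + s) (b + 1) n g (by omega) (by omega) (by omega) ?_ hgne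
          convert hg using 1
          have : (t + 1) * (q - 1) = t * (q - 1) + (q - 1) := by ring
          have h' : t.succ * (q - 1) = t * (q - 1) + (q - 1) := this
          rw [h'] at hr'
          omega)
      refine le_trans ?_ this
      rw [← mul_assoc]
      refine Nat.mul_le_mul_right _ ?_
      obtain ⟨k'', rfl⟩ : ∃ k'', k' = k'' + 1 := ⟨k' - 1, by omega⟩
      have : e = k'' + 1 + b := by omega
      rw [this]
      nlinarith [Nat.zero_le (k'' * b)]

theorem pencil [Fintype F] [Finite V] (f : V → F) (φ φ0 : V →ₗ[F] F) (c1 c0 : F)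
    (h : ∀ x, f x ≠ 0 → φ x = c1 → φ0 x = c0) :
    ∃ l : F, Fintype.card F * Ww f φ c1 + Nw f ≤
      Fintype.card F * Ww f (φ0 + l • φ) (c0 + l * c1) + Ww f φ c1 := by
  classical
  have := Fintype.ofFinite V
  have key : ∑ l : F, Ww f (φ0 + l • φ) (c0 + l * c1) + Ww f φ c1
      = Fintype.card F * Ww f φ c1 + Nw f := by
    have h1 : ∀ l : F, Ww f (φ0 + l • φ) (c0 + l * c1) = Ww f φ c1 +
        ((Finset.univ.filter (fun x => f x ≠ 0 ∧ φ x ≠ c1)).filter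
          (fun x => - (φ0 x - c0) / (φ x - c1) = l)).card := by
      intro l
      unfold Ww
      simp only [Set.ncard_eq_toFinset_card']
      rw [← Finset.card_union_of_disjoint]
      · congr 1
        ext x
        simp only [Set.mem_toFinset, Set.mem_ofPred_eq, Finset.mem_union, Finset.mem_filter,
          Finset.mem_univ, true_and, LinearMap.add_apply, LinearMap.smul_apply, smul_eq_mul]
        by_cases hx : f x ≠ 0
        · by_cases hc : φ x = c1
          · simp [hx, hc, h x hx hc]
          · have : φ x - c1 ≠ 0 := sub_ne_zero.2 hc
            simp only [hx, hc, ne_eq, not_false_eq_true, true_and, and_false, false_or]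
            rw [div_eq_iff this]
            constructor
            · intro h; linear_combination -h
            · intro h; linear_combination -h
        · simp [hx]
      · rw [Finset.disjoint_left]
        intro x
        simp only [Set.mem_toFinset, Set.mem_ofPred_eq, Finset.mem_filter]
        tauto
    simp only [h1]
    have h4 := Finset.card_eq_sum_card_fiberwise (f := fun x => - (φ0 x - c0) / (φ x - c1))
      (s := Finset.univ.filter (fun x => f x ≠ 0 ∧ φ x ≠ c1)) (t := Finset.univ) (by simp)
    rw [Finset.sum_add_distrib, ← h4]
    have h2 : (Finset.univ.filter (fun x => f x ≠ 0 ∧ φ x ≠ c1)).card + Ww f φ c1 = Nw f := by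
      unfold Ww Nw
      simp only [Set.ncard_eq_toFinset_card']
      rw [← Finset.card_union_of_disjoint]
      · congr 1
        ext x
        simp
        tauto
      · rw [Finset.disjoint_left]
        intro x
        simp only [Set.mem_toFinset, Set.mem_ofPred_eq, Finset.mem_filter]
        tauto
    simp only [Finset.sum_const, Finset.card_univ, smul_eq_mul]
    omega
  by_contra! hc
  have h3 : ∑ l : F, (Fintype.card F * Ww f (φ0 + l • φ) (c0 + l * c1) + Ww f φ c1)
      < ∑ l : F, (Fintype.card F * Ww f φ c1 + Nw f) :=
    Finset.sum_lt_sum_of_nonempty Finset.univ_nonempty (fun l _ => hc l)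
  rw [Finset.sum_add_distrib, ← Finset.mul_sum] at h3
  simp only [Finset.sum_const, Finset.card_univ, smul_eq_mul] at h3
  rw [← mul_add, key] at h3
  exact lt_irrefl _ h3

noncomputable def hm {A : Type} [CommRing A] [Algebra F A] (n : ℕ) (P : Polynomial F) (x z : A) : A :=
  ∑ kl ∈ Finset.HasAntidiagonal.antidiagonal n, P.coeff kl.1 • (x ^ kl.1 * z ^ kl.2)

theorem hm_eq {A : Type} [CommRing A] [Algebra F A] (n : ℕ) (P : Polynomial F) (x z : A) :
    hm n P x z = MvPolynomial.aeval ![x, z] (P.homogenize n) := by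
  unfold hm Polynomial.homogenize
  rw [map_sum]
  refine Finset.sum_congr rfl fun kl _ => ?_
  rw [MvPolynomial.aeval_monomial, Algebra.smul_def]
  congr 1
  rw [Finsupp.prod_fintype _ _ (by simp)]
  simp [Fin.prod_univ_two]

theorem hm_mul {A : Type} [CommRing A] [Algebra F A] (n k : ℕ) (P Q : Polynomial F) (x z : A)
    (hP : P.natDegree ≤ n) (hQ : Q.natDegree ≤ k) :
    hm (n + k) (P * Q) x z = hm n P x z * hm k Q x z := by
  rw [hm_eq, hm_eq, hm_eq, Polynomial.homogenize_mul _ _ hP hQ, map_mul]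

theorem hm_add {A : Type} [CommRing A] [Algebra F A] (n : ℕ) (P Q : Polynomial F) (x z : A) :
    hm n (P + Q) x z = hm n P x z + hm n Q x z := by
  rw [hm_eq, hm_eq, hm_eq, Polynomial.homogenize_add, map_add]

theorem hm_apply {Z : Type} (n : ℕ) (P : Polynomial F) (x z : Z → F) (p : Z) :
    hm n P x z p = hm n P (x p) (z p) := by
  simp [hm]

noncomputable def Low {Z : Type} (x z : Z → F) (n : ℕ) : Submodule F (Z → F) :=
  Submodule.span F {h | ∃ a b, a + b < n ∧ h = x ^ a * z ^ b}

theorem Low_mon {Z : Type} (x z : Z → F) {n a b : ℕ} (h : a + b < n) : x ^ a * z ^ b ∈ Low x z n :=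
  Submodule.subset_span ⟨a, b, h, rfl⟩

theorem Low_mono {Z : Type} (x z : Z → F) {n k : ℕ} (h : n ≤ k) : Low x z n ≤ Low x z k := by
  apply Submodule.span_mono
  rintro _ ⟨a, b, hab, rfl⟩
  exact ⟨a, b, by omega, rfl⟩

theorem Low_mul {Z : Type} (x z : Z → F) {n a b : ℕ} {h : Z → F} (hh : h ∈ Low x z n) :
    x ^ a * z ^ b * h ∈ Low x z (n + a + b) := by
  induction hh using Submodule.span_induction with
  | mem h hh =>
    obtain ⟨c, d, hcd, rfl⟩ := hh
    have : x ^ a * z ^ b * (x ^ c * z ^ d) = x ^ (a + c) * z ^ (b + d) := by ring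
    rw [this]
    exact Low_mon _ _ (by omega)
  | zero => simp
  | add h k _ _ ih1 ih2 => rw [mul_add]; exact Submodule.add_mem _ ih1 ih2
  | smul c h _ ih => rw [mul_smul_comm]; exact Submodule.smul_mem _ _ ih

theorem hm_Low {Z : Type} (x z : Z → F) (n : ℕ) (P : Polynomial F) :
    hm n P x z ∈ Low x z (n + 1) := by
  unfold hm
  refine Submodule.sum_mem _ fun kl hkl => Submodule.smul_mem _ _ (Low_mon _ _ ?_)
  rw [Finset.HasAntidiagonal.mem_antidiagonal] at hkl; omega

theorem hm_mul_Low {Z : Type} (x z : Z → F) {n k : ℕ} (P : Polynomial F) {h : Z → F}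
    (hh : h ∈ Low x z k) : h * hm n P x z ∈ Low x z (k + n) := by
  unfold hm
  rw [Finset.mul_sum]
  refine Submodule.sum_mem _ fun kl hkl => ?_
  rw [mul_smul_comm, mul_comm]
  refine Submodule.smul_mem _ _ ?_
  rw [Finset.HasAntidiagonal.mem_antidiagonal] at hkl
  have := Low_mul (a := kl.1) (b := kl.2) x z hh
  rwa [add_assoc, hkl] at this

/-- key reduction step -/
theorem red_step {Z : Type} (x z : Z → F) (S : Submodule F (Z → F)) (P : Polynomial F) (D i a b : ℕ)
    (hi : P.natDegree = i) (hP : P ≠ 0) (hiD : i ≤ D) (hL : hm D P x z ∈ Low x z D)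
    (hS : Low x z (a + b) ≤ S) (ha : i ≤ a) (hb : D - i ≤ b)
    (ih : ∀ a' b', a' + b' = a + b → a' < a → x ^ a' * z ^ b' ∈ S) : x ^ a * z ^ b ∈ S := by
  have h1 : x ^ (a - i) * z ^ (b - (D - i)) * hm D P x z ∈ S := by
    apply hS
    have := Low_mul (a := a - i) (b := b - (D - i)) x z hL
    exact Low_mono x z (by omega) this
  have h2 : hm D P x z = P.coeff i • (x ^ i * z ^ (D - i)) +
      ∑ kl ∈ (Finset.HasAntidiagonal.antidiagonal D).erase (i, D - i), P.coeff kl.1 • (x ^ kl.1 * z ^ kl.2) := by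
    unfold hm
    exact (Finset.add_sum_erase (HasAntidiagonal.antidiagonal D)
      (fun kl : ℕ × ℕ => P.coeff kl.1 • (x ^ kl.1 * z ^ kl.2)) (a := (i, D - i))
      (by rw [Finset.HasAntidiagonal.mem_antidiagonal]; simp only; omega)).symm
  rw [h2, mul_add, Finset.mul_sum] at h1
  have h3 : ∑ kl ∈ (Finset.HasAntidiagonal.antidiagonal D).erase (i, D - i), x ^ (a - i) * z ^ (b - (D - i)) *
      P.coeff kl.1 • (x ^ kl.1 * z ^ kl.2) ∈ S := by
    refine Submodule.sum_mem _ fun kl hkl => ?_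
    rw [Finset.mem_erase, Finset.HasAntidiagonal.mem_antidiagonal] at hkl
    obtain ⟨hne, hkl⟩ := hkl
    rw [mul_smul_comm]
    by_cases hk : kl.1 < i
    · refine Submodule.smul_mem _ _ ?_
      have : x ^ (a - i) * z ^ (b - (D - i)) * (x ^ kl.1 * z ^ kl.2) =
        x ^ (a - i + kl.1) * z ^ (b - (D - i) + kl.2) := by ring
      rw [this]
      exact ih _ _ (by omega) (by omega)
    · have : i < kl.1 := by
        rcases Nat.lt_or_ge i kl.1 with h | h
        · exact h
        · exfalso; apply hne; ext <;> simp <;> omega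
      rw [Polynomial.coeff_eq_zero_of_natDegree_lt (by omega)]
      simp
  have h4 := (Submodule.add_mem_iff_left _ h3).1 h1
  have h5 : x ^ (a - i) * z ^ (b - (D - i)) * P.coeff i • (x ^ i * z ^ (D - i)) =
      P.coeff i • (x ^ a * z ^ b) := by
    rw [mul_smul_comm]
    congr 1
    have e1 : x ^ a = x ^ (a - i) * x ^ i := by rw [← pow_add]; congr 1; omega
    have e2 : z ^ b = z ^ (b - (D - i)) * z ^ (D - i) := by rw [← pow_add]; congr 1; omega
    rw [e1, e2]; ring
  rw [h5] at h4
  refine (Submodule.smul_mem_iff _ ?_).1 h4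
  rw [← hi]
  exact Polynomial.leadingCoeff_ne_zero.2 hP

theorem mon_top [Fintype F] (Z : Finset (F × F)) (S : Submodule F (Z → F))
    (h : ∀ a b, ((fun p : Z => p.1.1) ^ a * (fun p : Z => p.1.2) ^ b) ∈ S) : S = ⊤ := by
  classical
  rw [eq_top_iff]
  rintro f -
  have hint : ∀ c : F, ∃ P : Polynomial F, ∀ x, P.eval x = if x = c then 1 else 0 := by
    intro c
    refine ⟨Lagrange.interpolate Finset.univ id (fun x => if x = c then 1 else 0), fun x => ?_⟩
    have := Lagrange.eval_interpolate_at_node (s := Finset.univ) (v := id) (i := x)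
      (fun x => if x = c then (1 : F) else 0) (Function.injective_id.injOn) (by simp)
    simpa using this
  choose P hP using hint
  have : f = ∑ c : Z, f c • (∑ i ∈ (P c.1.1).support, ∑ j ∈ (P c.1.2).support,
      ((P c.1.1).coeff i * (P c.1.2).coeff j) •
      ((fun p : Z => p.1.1) ^ i * (fun p : Z => p.1.2) ^ j)) := by
    have h1 : ∀ c : Z, (∑ i ∈ (P c.1.1).support, ∑ j ∈ (P c.1.2).support,
      ((P c.1.1).coeff i * (P c.1.2).coeff j) •
      ((fun p : Z => p.1.1) ^ i * (fun p : Z => p.1.2) ^ j)) = fun p => if p = c then 1 else 0 := by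
      intro c
      ext p
      have : (if p = c then (1 : F) else 0) = (P c.1.1).eval p.1.1 * (P c.1.2).eval p.1.2 := by
        rw [hP, hP]
        have : p = c ↔ p.1.1 = c.1.1 ∧ p.1.2 = c.1.2 := by
          rw [Subtype.ext_iff, Prod.ext_iff]
        simp only [this]
        split_ifs <;> simp_all
      rw [this, Polynomial.eval_eq_sum, Polynomial.eval_eq_sum, Polynomial.sum, Polynomial.sum,
        Finset.sum_mul_sum]
      simp only [Finset.sum_apply, Pi.smul_apply, Pi.mul_apply, Pi.pow_apply, smul_eq_mul]
      refine Finset.sum_congr rfl fun i _ => Finset.sum_congr rfl fun j _ => by ring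
    simp only [h1]
    ext p
    simp [Finset.sum_apply]
  rw [this]
  exact Submodule.sum_mem _ fun c _ => Submodule.smul_mem _ _ <| Submodule.sum_mem _ fun i _ =>
    Submodule.sum_mem _ fun j _ => Submodule.smul_mem _ _ (h i j)

theorem plane [Fintype F] [DecidableEq F] {q s : ℕ} (hq : Fintype.card F = q) (hs : 2 ≤ s) (hsq : s < q)
    (P : Polynomial F) (hPd : P.natDegree = s) (hroot : ∀ a, P.eval a ≠ 0) (Z : Finset (F × F))
    (hZ : hm s P (fun p : Z => p.1.1) (fun p : Z => p.1.2) ∈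
      Low (fun p : Z => p.1.1) (fun p : Z => p.1.2) s) : Z.card + (s - 1) ≤ s * q := by
  set x : Z → F := fun p => p.1.1 with hx
  set z : Z → F := fun p => p.1.2 with hz
  have hP0 : P ≠ 0 := by rintro rfl; simp at hPd; omega
  have hxq : ∀ y : F, y ^ q = y := by intro y; rw [← hq]; exact FiniteField.pow_card y
  set C := (Polynomial.X ^ q : Polynomial F) % P with hC
  set h := (Polynomial.X ^ q : Polynomial F) / P with hh
  have hdiv : P * h + C = Polynomial.X ^ q := EuclideanDomain.div_add_mod _ _
  have hCd : C.natDegree < s := by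
    rw [← hPd]; exact Polynomial.natDegree_mod_lt _ (by omega)
  have hCc : 1 ≤ C.natDegree := by
    by_contra hc
    have h0 : C.natDegree = 0 := by omega
    obtain ⟨c, hc⟩ := Polynomial.natDegree_eq_zero.1 h0
    obtain ⟨p, hpp⟩ := CharP.exists F
    obtain ⟨⟨n, hn⟩, hp, hcard⟩ := FiniteField.card F p
    have := Fact.mk hp
    have : P ∣ (Polynomial.X - Polynomial.C c) ^ q := by
      have e : (Polynomial.X - Polynomial.C c : Polynomial F) ^ q =
          Polynomial.X ^ q - Polynomial.C c := by
        have hcard' : q = p ^ n := by rw [← hq, hcard]; rfl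
        rw [hcard', sub_pow_char_pow, ← hcard', ← Polynomial.C_pow, hxq]
      rw [e, hc, ← hdiv]
      exact ⟨h, by ring⟩
    obtain ⟨i, hi, hass⟩ := (dvd_prime_pow (Polynomial.prime_X_sub_C c) q).1 this
    have hi0 : i ≠ 0 := by
      rintro rfl
      have := Polynomial.natDegree_eq_of_degree_eq (Polynomial.degree_eq_degree_of_associated hass)
      simp at this; omega
    apply hroot c
    obtain ⟨w, hw⟩ := hass.symm.dvd
    have : (Polynomial.X - Polynomial.C c) ∣ P :=
      (dvd_pow_self _ hi0).trans hass.symm.dvd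
    exact Polynomial.dvd_iff_isRoot.1 this
  set i := C.natDegree with hidef
  have hC0 : C ≠ 0 := by rintro h0; rw [hidef, h0] at hCc; simp at hCc
  have hhd : h.natDegree ≤ q - s := by
    by_cases h0 : h = 0
    · simp [h0]
    have h1 := Polynomial.natDegree_mul hP0 h0
    have h2 : P * h = Polynomial.X ^ q - C := by rw [← hdiv]; ring
    have h3 := Polynomial.natDegree_sub_le (Polynomial.X ^ q) C
    rw [← h2, h1, Polynomial.natDegree_X_pow] at h3
    omega
  have hCL : hm q C x z ∈ Low x z q := by
    have e : hm q C x z = x ^ q - hm s P x z * hm (q - s) h x z := by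
      rw [← hm_mul s (q - s) P h x z (by omega) hhd]
      have : s + (q - s) = q := by omega
      rw [this, eq_sub_iff_add_eq, add_comm, ← hm_add, hdiv, hm_eq,
        Polynomial.homogenize_X_pow le_rfl]
      simp
    rw [e]
    refine Submodule.sub_mem _ ?_ ?_
    · have : x ^ q = x ^ 1 * z ^ 0 := by ext p; simp [hxq]
      rw [this]
      exact Low_mon _ _ (by omega)
    · have := hm_mul_Low (n := q - s) x z h hZ
      exact Low_mono x z (by omega) this
  set B : Finset (ℕ × ℕ) := (Finset.range s ×ˢ Finset.range q) \
    (Finset.Ico i s ×ˢ Finset.Ico (q - i) q) with hB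
  set S := Submodule.span F ((fun ab : ℕ × ℕ => x ^ ab.1 * z ^ ab.2) '' (B : Set (ℕ × ℕ))) with hS
  have hall : ∀ n, ∀ a b, a + b = n → x ^ a * z ^ b ∈ S := by
    intro n
    induction n using Nat.strong_induction_on with
    | _ n ihn =>
    have hlow : Low x z n ≤ S := by
      refine Submodule.span_le.2 ?_
      rintro _ ⟨a, b, hab, rfl⟩
      exact ihn _ hab a b rfl
    intro a
    induction a using Nat.strong_induction_on with
    | _ a iha =>
    intro b hab
    by_cases hbq : q ≤ b
    · have : z ^ b = z ^ (b - q + 1) := by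
        have e : z ^ q = z := by ext p; simp [hxq]
        have : b = q + (b - q) := by omega
        conv_lhs => rw [this, pow_add, e]
        rw [pow_succ, mul_comm]
      rw [this]
      exact hlow (Low_mon _ _ (by omega))
    by_cases has : s ≤ a
    · exact red_step x z S P s s a b hPd hP0 le_rfl hZ (by rw [hab]; exact hlow) has (by omega)
        (fun a' b' h1 h2 => iha a' h2 b' (by omega))
    by_cases hai : i ≤ a ∧ q - i ≤ b
    · exact red_step x z S C q i a b rfl hC0 (by omega) hCL (by rw [hab]; exact hlow) hai.1 hai.2
        (fun a' b' h1 h2 => iha a' h2 b' (by omega))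
    · refine Submodule.subset_span ⟨(a, b), ?_, rfl⟩
      rw [Finset.mem_coe, hB, Finset.mem_sdiff, Finset.mem_product, Finset.mem_product,
        Finset.mem_range, Finset.mem_range, Finset.mem_Ico, Finset.mem_Ico]
      simp only
      omega
  have htop := mon_top Z S (fun a b => hall _ a b rfl)
  have hcardS : Z.card ≤ B.card := by
    have h1 := finrank_span_finset_le_card (R := F) (B.image (fun ab : ℕ × ℕ => x ^ ab.1 * z ^ ab.2))
    rw [Set.finrank, Finset.coe_image, ← hS, htop, finrank_top] at h1
    simp only [Module.finrank_fintype_fun_eq_card, Fintype.card_coe] at h1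
    exact h1.trans Finset.card_image_le
  have hBc : B.card + (s - i) * i = s * q := by
    rw [hB]
    have := Finset.card_sdiff_add_card_eq_card (s := Finset.Ico i s ×ˢ Finset.Ico (q - i) q)
      (t := Finset.range s ×ˢ Finset.range q) (by
        intro p
        simp only [Finset.mem_product, Finset.mem_Ico, Finset.mem_range]
        omega)
    simp only [Finset.card_product, Nat.card_Ico, Finset.card_range] at this ⊢
    have e : q - (q - i) = i := by omega
    rwa [e] at this
  have : s - 1 ≤ (s - i) * i := by
    obtain ⟨j, hj⟩ : ∃ j, s = i + 1 + j := ⟨s - i - 1, by omega⟩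
    obtain ⟨k, hk⟩ : ∃ k, i = k + 1 := ⟨i - 1, by omega⟩
    have e1 : s - i = j + 1 := by omega
    rw [e1, hk]
    have : s - 1 = k + 1 + j := by omega
    rw [this]
    nlinarith [Nat.zero_le (j * k)]
  omega

theorem taylor {r : ℕ} {f : V → F} (h : Dg r f) : ∃ Λ : V → F,
    (∀ v, ∃ a : ℕ → V → F, (∀ i ≤ r, Dg (r - i) (a i)) ∧ (∀ i, r < i → a i = 0) ∧
      (∀ y, a r y = Λ v) ∧ ∀ y (x : F), f (y + x • v) = ∑ i ∈ Finset.range (r + 1), x ^ i * a i y) ∧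
    (∀ u v, ∃ P : Polynomial F, P.natDegree ≤ r ∧ ∀ x z : F, Λ (x • u + z • v) = hm r P x z) ∧
    (∀ u v y (Z : Type) (x z : Z → F),
      (fun p => f (y + (x p • u + z p • v)) - Λ (x p • u + z p • v)) ∈ Low x z r) := by
  induction h with
  | const r c =>
    cases r with
    | zero =>
      refine ⟨fun _ => c, ?_, ?_, ?_⟩
      · intro v
        refine ⟨fun i => if i = 0 then fun _ => c else 0, ?_, ?_, ?_, ?_⟩
        · intro i hi
          have : i = 0 := by omega
          subst this
          simpa using Dg.const _ _
        · intro i hi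
          have : i ≠ 0 := by omega
          simp [this]
        · intro y; simp
        · intro y x; simp
      · intro u v
        exact ⟨Polynomial.C c, by simp, by intro x z; simp [hm]⟩
      · intro u v y Z x z
        simp
        exact Submodule.zero_mem _
    | succ r =>
      refine ⟨fun _ => 0, ?_, ?_, ?_⟩
      · intro v
        refine ⟨fun i => if i = 0 then fun _ => c else 0, ?_, ?_, ?_, ?_⟩
        · intro i hi
          by_cases hi : i = 0
          · simp only [hi, if_true]; exact Dg.const _ _
          · simp only [hi, if_false]; exact Dg.const _ _
        · intro i hi
          have : i ≠ 0 := by omega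
          simp [this]
        · intro y; simp
        · intro y x
          rw [Finset.sum_eq_single 0]
          · simp
          · intro b _ hb; simp [hb]
          · simp
      · intro u v
        exact ⟨0, by simp, by intro x z; simp [hm]⟩
      · intro u v y Z x z
        have : (fun p : Z => c - 0) = c • (x ^ 0 * z ^ 0) := by ext p; simp
        rw [this]
        exact Submodule.smul_mem _ _ (Low_mon _ _ (by omega))
  | @add r f g _ _ ih1 ih2 =>
    obtain ⟨L1, a1, b1, c1⟩ := ih1
    obtain ⟨L2, a2, b2, c2⟩ := ih2
    refine ⟨fun v => L1 v + L2 v, ?_, ?_, ?_⟩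
    · intro v
      obtain ⟨A1, p1, q1, r1, s1⟩ := a1 v
      obtain ⟨A2, p2, q2, r2, s2⟩ := a2 v
      refine ⟨fun i y => A1 i y + A2 i y, ?_, ?_, ?_, ?_⟩
      · intro i hi; exact Dg.add (p1 i hi) (p2 i hi)
      · intro i hi; simp only [q1 i hi, q2 i hi]; ext y; simp
      · intro y; simp only [r1, r2]
      · intro y x; change f _ + g _ = _; rw [s1, s2, ← Finset.sum_add_distrib]
        refine Finset.sum_congr rfl fun i _ => by ring
    · intro u v
      obtain ⟨P1, d1, e1⟩ := b1 u v
      obtain ⟨P2, d2, e2⟩ := b2 u v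
      exact ⟨P1 + P2, Polynomial.natDegree_add_le_of_degree_le d1 d2,
        fun x z => by change L1 _ + L2 _ = _; rw [hm_add, e1, e2]⟩
    · intro u v y Z x z
      have := Submodule.add_mem _ (c1 u v y Z x z) (c2 u v y Z x z)
      convert this using 1
      ext p
      simp only [Pi.add_apply]; ring
  | @mul r f φ hf ih =>
    obtain ⟨L1, a1, b1, c1⟩ := ih
    refine ⟨fun v => φ v * L1 v, ?_, ?_, ?_⟩
    · intro v
      obtain ⟨A1, p1, q1, r1, s1⟩ := a1 v
      refine ⟨fun i y => φ y * A1 i y + φ v * (if i = 0 then 0 else A1 (i - 1) y), ?_, ?_, ?_, ?_⟩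
      · intro i hi
        refine Dg.add ?_ ?_
        · by_cases hir : i ≤ r
          · have := Dg.mul φ (p1 i hir)
            have e : r + 1 - i = r - i + 1 := by omega
            rw [e]; exact this
          · have := q1 i (by omega)
            simp only [this, Pi.zero_apply, mul_zero]
            exact Dg.const _ _
        · refine Dg.cmul _ ?_
          by_cases hi0 : i = 0
          · simp only [hi0, if_true]; exact Dg.const _ _
          · simp only [hi0, if_false]
            have := p1 (i - 1) (by omega)
            have e : r + 1 - i = r - (i - 1) := by omega
            rw [e]; exact this
      · intro i hi
        have hi0 : i ≠ 0 := by omega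
        ext y
        simp [q1 i (by omega), q1 (i - 1) (by omega)]
      · intro y; simp [r1, q1 (r + 1) (by omega)]
      · intro y x
        simp only [mul_add, Finset.sum_add_distrib]
        rw [Finset.sum_range_succ, q1 (r + 1) (by omega),
          Finset.sum_range_succ' (fun i => x ^ i * (φ v * if i = 0 then 0 else A1 (i - 1) y))]
        simp only [Pi.zero_apply, mul_zero, add_zero, if_true, Nat.add_sub_cancel,
          Nat.add_eq_zero_iff, one_ne_zero, and_false, if_false, s1, map_add, map_smul, smul_eq_mul]
        rw [add_mul, Finset.mul_sum, Finset.mul_sum]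
        congr 1
        · refine Finset.sum_congr rfl fun i _ => by ring
        · refine Finset.sum_congr rfl fun i _ => by ring
    · intro u v
      obtain ⟨P1, d1, e1⟩ := b1 u v
      have hd : (Polynomial.C (φ u) * Polynomial.X + Polynomial.C (φ v)).natDegree ≤ 1 :=
        Polynomial.natDegree_linear_le
      refine ⟨P1 * (Polynomial.C (φ u) * Polynomial.X + Polynomial.C (φ v)), ?_, fun x z => ?_⟩
      · exact Polynomial.natDegree_mul_le.trans (by omega)
      · rw [hm_mul r 1 _ _ _ _ d1 hd, ← e1]
        have : hm 1 (Polynomial.C (φ u) * Polynomial.X + Polynomial.C (φ v)) x z =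
            φ u * x + φ v * z := by
          rw [hm_eq, Polynomial.homogenize_add, Polynomial.homogenize_C_mul,
            Polynomial.homogenize_C, Polynomial.homogenize_X one_ne_zero]
          simp
        rw [this]
        simp only [map_add, map_smul, smul_eq_mul]; ring
    · intro u v y Z x z
      obtain ⟨P1, d1, e1⟩ := b1 u v
      have h0 := c1 u v y Z x z
      have h1 := hm_Low x z r P1
      have h2 := Low_mul (a := 1) (b := 0) x z h0
      have h3 := Low_mul (a := 0) (b := 1) x z h0
      have := Submodule.add_mem _ (Submodule.add_mem _ (Submodule.smul_mem _ (φ y) h1)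
        (Submodule.smul_mem _ (φ y) (Low_mono x z (Nat.le_succ r) h0)))
        (Submodule.add_mem _ (Submodule.smul_mem _ (φ u) h2) (Submodule.smul_mem _ (φ v) h3))
      convert this using 1
      ext p
      simp only [Pi.add_apply, Pi.smul_apply, Pi.mul_apply, Pi.pow_apply, hm_apply, ← e1, map_add,
        map_smul, smul_eq_mul, pow_zero, pow_one, Pi.one_apply]
      ring

theorem dcount [Finite V] {ι : Type} [Fintype ι] (f : V → F) (w : ι → V) (S : Set V) (k : ℕ)
    (h : ∀ y ∈ S, k ≤ Set.ncard {i | f (y + w i) ≠ 0}) : k * S.ncard ≤ Fintype.card ι * Nw f := by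
  classical
  have := Fintype.ofFinite V
  have h1 : ∀ i, (Finset.univ.filter (fun y => f (y + w i) ≠ 0)).card = Nw f := by
    intro i
    unfold Nw
    rw [Set.ncard_eq_toFinset_card']
    refine Finset.card_bij (fun y _ => y + w i) ?_ ?_ ?_
    · intro y hy; simpa using hy
    · intro a _ b _ hab; simpa using hab
    · intro b hb; exact ⟨b - w i, by simpa using hb, by simp⟩
  have h2 : Fintype.card ι * Nw f = ∑ i : ι, ∑ y : V, if f (y + w i) ≠ 0 then 1 else 0 := by
    simp only [Finset.sum_boole, Nat.cast_id, h1]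
    simp
  rw [h2, Finset.sum_comm, Set.ncard_eq_toFinset_card']
  calc k * S.toFinset.card = ∑ y ∈ S.toFinset, k := by simp [mul_comm]
    _ ≤ ∑ y ∈ S.toFinset, ∑ i : ι, (if f (y + w i) ≠ 0 then 1 else 0) := by
      refine Finset.sum_le_sum fun y hy => ?_
      have := h y (by simpa using hy)
      rw [Set.ncard_eq_toFinset_card'] at this
      rw [Finset.sum_boole]
      simpa using this
    _ ≤ _ := Finset.sum_le_sum_of_subset (Finset.subset_univ _)

theorem Flem [Fintype F] {q : ℕ} (hq : Fintype.card F = q) : ∀ (n : ℕ) (V : Type) [AddCommGroup V]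
    [Module F V] [Finite V], Module.finrank F V = 1 + n → ∀ (s e : ℕ) (f : V → F),
    s + e = q → 2 ≤ e → 1 ≤ s → Dg s f → (∃ x, f x ≠ 0) →
    q * Nw f < (e * q + (s - 1)) * q ^ n → Nw f = e * q ^ n := by
  classical
  intro n
  induction n with
  | zero =>
    intro V _ _ _ hV s e f hse he hs hf hne hlt
    have h1 := MD hq _ V hV 0 s e 0 f (by omega) hse (by omega) (by simpa using hf) hne
    simp only [pow_zero, mul_one] at *
    by_contra hc
    have : e + 1 ≤ Nw f := by omega
    have := Nat.mul_le_mul_left q this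
    rw [mul_add, mul_comm q e] at this
    omega
  | succ n ih =>
    intro V _ _ _ hV s e f hse he hs hf hne hlt
    have hMD := MD hq _ V hV 0 s e (n + 1) f (by omega) hse (by omega) (by simpa using hf) hne
    by_cases hs1 : s = 1
    · exfalso
      subst hs1
      simp only [Nat.sub_self, add_zero] at hlt
      have := Nat.mul_le_mul_left q hMD
      nlinarith
    obtain ⟨Λ, hA, hB, hC⟩ := taylor hf
    by_cases hinv : ∃ v ≠ 0, ∀ y (x : F), f (y + x • v) = f y
    · obtain ⟨v, hv, hinv⟩ := hinv
      obtain ⟨φ, hφv⟩ : ∃ φ : V →ₗ[F] F, φ v = 1 := by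
        obtain ⟨φ, hφ⟩ : ∃ φ : V →ₗ[F] F, φ v ≠ 0 := by
          by_contra! hc
          exact hv ((Module.forall_dual_apply_eq_zero_iff F v).1 hc)
        exact ⟨(φ v)⁻¹ • φ, by simp [hφ]⟩
      have hφ : φ ≠ 0 := by rintro rfl; simp at hφv
      have hker := finrank_ker1 φ hφ
      have hg := hf.pull (LinearMap.ker φ).subtype 0
      set g : LinearMap.ker φ → F := fun w => f (0 + (LinearMap.ker φ).subtype w) with hgd
      have hga : ∀ w, g w = f w := by intro w; simp [hgd]
      have hW : ∀ c, Ww f φ c = Nw g := by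
        intro c
        unfold Ww Nw
        have : {x | f x ≠ 0 ∧ φ x = c} = (fun w : LinearMap.ker φ => (w : V) + c • v) '' {w | g w ≠ 0} := by
          ext x
          simp only [Set.mem_ofPred_eq, Set.mem_image]
          constructor
          · rintro ⟨h1, h2⟩
            refine ⟨⟨x - c • v, by simp [hφv, h2]⟩, ?_, by simp⟩
            rw [hga, ← hinv _ c]; simpa using h1
          · rintro ⟨w, h1, rfl⟩
            rw [hinv, ← hga]
            refine ⟨h1, ?_⟩
            have := LinearMap.mem_ker.1 w.2
            simp [this, hφv]
        rw [this, Set.ncard_image_of_injective]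
        intro a b hab
        simpa using hab
      have hN : Nw f = q * Nw g := by
        rw [← sum_Ww f φ]; simp [hW, hq]
      have hq0 : 0 < q := by omega
      have := ih (LinearMap.ker φ) (by omega) s e g hse he hs hg (by
        by_contra! hc
        have : Nw g = 0 := by unfold Nw; simp [hc]
        rw [this] at hN
        have : 0 < e * q ^ (n + 1) := by positivity
        omega) (by
        rw [hN, pow_succ] at hlt
        refine Nat.lt_of_mul_lt_mul_left (a := q) ?_
        calc _ < _ := hlt
          _ = _ := by ring)
      rw [hN, this]; ring
    · exfalso
      push Not at hinv
      have hΛ : ∀ v ≠ 0, Λ v ≠ 0 := by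
        intro v hv hΛ0
        obtain ⟨a, ha1, ha2, ha3, ha4⟩ := hA v
        obtain ⟨y0, x0, hy0⟩ := hinv v hv
        have hex : ((Finset.range (s + 1)).filter (fun i => a i ≠ 0)).Nonempty := by
          by_contra hc
          rw [Finset.not_nonempty_iff_eq_empty, Finset.filter_eq_empty_iff] at hc
          have h0 : ∀ y (x : F), f (y + x • v) = 0 := by
            intro y x
            rw [ha4]
            refine Finset.sum_eq_zero fun i hi => ?_
            have := hc hi
            push Not at this
            rw [this]; simp
          obtain ⟨x, hx⟩ := hne
          apply hx
          simpa using h0 x 0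
        obtain ⟨d, hd, hdm⟩ : ∃ d ∈ (Finset.range (s + 1)).filter (fun i => a i ≠ 0),
            ∀ i ∈ (Finset.range (s + 1)).filter (fun i => a i ≠ 0), i ≤ d :=
          ⟨_, Finset.max'_mem _ hex, fun i hi => Finset.le_max' _ i hi⟩
        rw [Finset.mem_filter, Finset.mem_range] at hd
        have hdm' : ∀ i, d < i → a i = 0 := by
          intro i hi
          by_contra hc
          by_cases his : i ≤ s
          · have := hdm i (by rw [Finset.mem_filter, Finset.mem_range]; exact ⟨by omega, hc⟩)
            omega
          · exact hc (ha2 i (by omega))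
        have hdne : ∃ y, a d y ≠ 0 := by
          by_contra! hc
          exact hd.2 (funext hc)
        have hd0 : d ≠ 0 := by
          rintro rfl
          apply hy0
          have e : ∀ x : F, f (y0 + x • v) = a 0 y0 := by
            intro x
            rw [ha4, Finset.sum_eq_single 0]
            · simp
            · intro i _ hi; rw [hdm' i (by omega)]; simp
            · simp
          rw [e, ← e 0]; simp
        have hds : d ≠ s := by
          rintro rfl
          obtain ⟨y, hy⟩ := hdne
          rw [ha3] at hy; exact hy hΛ0
        have h1 := MD hq _ V hV 0 (s - d) (e + d) (n + 1) (a d) (by omega) (by omega) (by omega)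
          (by simpa using ha1 d (by omega)) hdne
        have h2 := dcount f (fun x : F => x • v) {y | a d y ≠ 0} (q - d) (by
          intro y hy
          set R : Polynomial F := ∑ i ∈ Finset.range (s + 1), Polynomial.C (a i y) * Polynomial.X ^ i
            with hR
          have hRe : ∀ x, R.eval x = f (y + x • v) := by
            intro x
            rw [ha4, hR, Polynomial.eval_finsetSum]
            refine Finset.sum_congr rfl fun i _ => ?_
            rw [Polynomial.eval_mul, Polynomial.eval_C, Polynomial.eval_pow, Polynomial.eval_X, mul_comm]
          have hRc : ∀ j, R.coeff j = if j ≤ s then a j y else 0 := by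
            intro j
            rw [hR, Polynomial.finsetSum_coeff]
            simp only [Polynomial.coeff_C_mul, Polynomial.coeff_X_pow, mul_ite, mul_one, mul_zero]
            rw [Finset.sum_ite_eq]
            simp [Nat.lt_succ_iff]
          have hR0 : R ≠ 0 := by
            intro h0
            have := hRc d
            rw [h0, if_pos (by omega)] at this
            exact hy (by simpa using this.symm)
          have hRd : R.natDegree ≤ d := by
            rw [Polynomial.natDegree_le_iff_coeff_eq_zero]
            intro j hj
            rw [hRc, hdm' j hj]; simp
          have h3 : (Finset.univ.filter (fun x => R.eval x = 0)).card ≤ d := by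
            refine le_trans ?_ hRd
            refine le_trans ?_ (Polynomial.card_roots' R)
            refine le_trans ?_ (Multiset.toFinset_card_le R.roots)
            refine Finset.card_le_card ?_
            intro x hx
            simp only [Finset.mem_filter, Finset.mem_univ, true_and] at hx
            simp [hR0, hx]
          have h4 := Finset.card_filter_add_card_filter_not (s := (Finset.univ : Finset F))
            (fun x => R.eval x = 0)
          rw [Finset.card_univ, hq] at h4
          rw [Set.ncard_eq_toFinset_card']
          have h5 : {i : F | f (y + i • v) ≠ 0}.toFinset = Finset.univ.filter (fun x => ¬ R.eval x = 0) := by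
            ext x; simp [hRe]
          rw [h5]
          omega)
        rw [hq] at h2
        have h3 := (Nat.mul_le_mul_left (q - d) h1).trans h2
        have h4 := lt_of_le_of_lt h3 hlt
        rw [← mul_assoc] at h4
        have h5 := Nat.lt_of_mul_lt_mul_right h4
        obtain ⟨d', rfl⟩ : ∃ d', d = d' + 1 := ⟨d - 1, by omega⟩
        obtain ⟨b, hb⟩ : ∃ b, s = d' + 1 + 1 + b := ⟨s - d' - 2, by omega⟩
        have e1 : q - (d' + 1) = e + 1 + b := by omega
        have e2 : s - 1 = d' + 1 + b := by omega
        rw [e1, e2, ← hse, hb] at h5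
        nlinarith [Nat.zero_le (b * d')]
      obtain ⟨φ, hφ⟩ := exists_dual (F := F) (V := V) (by omega)
      obtain ⟨u, hu⟩ : ∃ u, φ u ≠ 0 := by
        by_contra! hc
        exact hφ (LinearMap.ext hc)
      have hker := finrank_ker1 φ hφ
      have : Nontrivial (LinearMap.ker φ) := Module.nontrivial_of_finrank_pos (R := F) (by omega)
      obtain ⟨v, hv⟩ := exists_ne (0 : LinearMap.ker φ)
      have hvφ : φ v = 0 := LinearMap.mem_ker.1 v.2
      have hind : ∀ x z : F, x • u + z • (v : V) = 0 → x = 0 ∧ z = 0 := by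
        intro x z h
        have h1 := congrArg φ h
        simp [hvφ, hu] at h1
        subst h1
        simp at h
        exact ⟨rfl, by simpa [hv] using h⟩
      obtain ⟨P, hPd, hP⟩ := hB u v
      have hPs : P.natDegree = s := by
        refine le_antisymm hPd (Polynomial.le_natDegree_of_ne_zero ?_)
        have h1 := hP 1 0
        have h2 : hm s P (1 : F) 0 = P.coeff s := by
          unfold hm
          rw [Finset.sum_eq_single (s, 0)]
          · simp
          · rintro ⟨a, b⟩ hab hne
            rw [Finset.HasAntidiagonal.mem_antidiagonal] at hab
            have : b ≠ 0 := by rintro rfl; apply hne; simp at hab; simp [hab]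
            simp [this]
          · intro h; exfalso; apply h; rw [Finset.HasAntidiagonal.mem_antidiagonal]; simp
        rw [← h2, ← h1]
        apply hΛ
        intro h
        have := hind _ _ h
        simp at this
      have hroot : ∀ a, P.eval a ≠ 0 := by
        intro a
        have h1 := hP a 1
        rw [hm_eq, Polynomial.aeval_homogenize_of_eq_one hPd _ (by simp)] at h1
        simp only [Matrix.cons_val_zero, Polynomial.coe_aeval_eq_eval] at h1
        rw [← h1]
        apply hΛ
        intro h
        have := hind _ _ h
        simp at this
      have h2 := dcount f (fun p : F × F => p.1 • u + p.2 • (v : V)) Set.univ (e * q + (s - 1)) (by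
        intro y _
        set Z : Finset (F × F) := Finset.univ.filter (fun p => f (y + (p.1 • u + p.2 • (v : V))) = 0)
          with hZ
        have h3 := plane hq (by omega) (by omega) P hPs hroot Z (by
          have := Submodule.neg_mem _ (hC u v y Z (fun p => p.1.1) (fun p => p.1.2))
          convert this using 1
          ext p
          have hp := Finset.mem_filter.1 p.2
          simp only [Pi.neg_apply, hp.2, hm_apply, ← hP]
          ring)
        have h4 := Finset.card_filter_add_card_filter_not (s := (Finset.univ : Finset (F × F)))
            (fun p => f (y + (p.1 • u + p.2 • (v : V))) = 0)
        rw [Finset.card_univ, Fintype.card_prod, hq, ← hZ] at h4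
        rw [Set.ncard_eq_toFinset_card']
        have h5 : {i : F × F | f (y + (i.1 • u + i.2 • (v : V))) ≠ 0}.toFinset =
            Finset.univ.filter (fun p => ¬ f (y + (p.1 • u + p.2 • (v : V))) = 0) := by
          ext x; simp
        rw [h5]
        have : q * q = s * q + e * q := by rw [← hse]; ring
        omega)
      rw [Fintype.card_prod, hq, Set.ncard_univ] at h2
      have hcV : Nat.card V = q ^ (1 + (n + 1)) := by
        rw [Module.natCard_eq_pow_finrank (K := F), hV, Nat.card_eq_fintype_card, hq]
      rw [hcV] at h2
      have h3 := Nat.mul_lt_mul_of_pos_left hlt (show 0 < q by omega)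
      rw [pow_add, pow_one] at h2
      nlinarith

theorem Dg.zero_const {r : ℕ} {f : V → F} (h : Dg r f) : r = 0 → ∃ c, ∀ x, f x = c := by
  induction h with
  | const r c => exact fun _ => ⟨c, fun _ => rfl⟩
  | add _ _ ih1 ih2 =>
    intro h
    obtain ⟨c, hc⟩ := ih1 h
    obtain ⟨d, hd⟩ := ih2 h
    exact ⟨c + d, fun x => by simp only [hc, hd]⟩
  | mul φ _ _ => intro h; omega

theorem hypslab [Fintype F] [Finite V] {q r : ℕ} (hq : Fintype.card F = q) {f : V → F} (h : Dg r f)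
    (hne : ∃ x, f x ≠ 0) (φ : V →ₗ[F] F) (hφ : φ ≠ 0) (c : F) (hc : ∀ x, f x ≠ 0 → φ x = c) :
    ∃ r', r = r' + (q - 1) ∧ ∃ g : LinearMap.ker φ → F, Dg r' g ∧ (∃ x, g x ≠ 0) ∧
      Nw g = Nw f ∧ ∃ p, φ p = c ∧ ∀ w, g w ≠ 0 ↔ f (p + w) ≠ 0 := by
  classical
  have hE : Em f φ = Finset.univ.erase c := by
    ext d
    rw [← not_iff_not, not_mem_Em]
    simp only [Finset.mem_erase, Finset.mem_univ, and_true, not_not]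
    constructor
    · rintro ⟨x, hx, rfl⟩; exact hc x hx
    · rintro rfl
      obtain ⟨x, hx⟩ := hne
      exact ⟨x, hx, hc x hx⟩
  have hEc : (Em f φ).card = q - 1 := by
    rw [hE, Finset.card_erase_of_mem (Finset.mem_univ _), Finset.card_univ, hq]
  obtain ⟨r', hr, g, hg, hgne, hN, hp⟩ := slab h φ hφ c (by rw [hE]; simp)
  refine ⟨r', by rw [← hEc]; exact hr, g, hg, hgne, ?_, hp⟩
  rw [hN]
  unfold Ww Nw
  congr 1
  ext x
  simp only [Set.mem_ofPred_eq]
  exact ⟨fun h => h.1, fun h => ⟨h, hc x h⟩⟩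

def TT (F : Type) [Field F] (q m : ℕ) : Prop := ∀ (V : Type) [AddCommGroup V]
    [Module F V] [Finite V], Module.finrank F V = m → ∀ (t s e n X : ℕ) (f : V → F),
    m = t + 1 + n → s + e = q → 1 ≤ s → 1 ≤ e → (1 ≤ t ∨ e = 1) → X + 1 ≤ s → X + 3 ≤ q →
    Dg (t * (q - 1) + s) f → q * Nw f ≤ (e * q + X) * q ^ n → InHyp f

theorem Glem [Fintype F] {q : ℕ} (hq : Fintype.card F = q) : ∀ (t m : ℕ)
    (_ : ∀ m' ≤ m, TT F q m') (V : Type) [AddCommGroup V]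
    [Module F V] [Finite V], Module.finrank F V = m → ∀ (s e n X : ℕ) (f : V → F),
    m = t + 1 + n → s + e = q → 1 ≤ s → 1 ≤ e → X + 1 ≤ s → X + 3 ≤ q →
    Dg (t * (q - 1) + s) f → (∃ x, f x ≠ 0) →
    (q * Nw f < (e * q + X) * q ^ n ∨ (e = 1 ∧ q * Nw f ≤ (e * q + X) * q ^ n)) →
    Nw f = e * q ^ n := by
  intro t
  induction t with
  | zero =>
    intro m hT V _ _ _ hV s e n X f hm hse hs he hXs hXq hf hne hN
    by_cases he1 : e = 1
    · have hN' : q * Nw f ≤ (e * q + X) * q ^ n := by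
        rcases hN with h | h
        · exact h.le
        · exact h.2
      obtain ⟨φ, hφ, c, hc⟩ := hT m le_rfl V hV 0 s e n X f hm hse hs he (Or.inr he1) hXs hXq hf hN'
      obtain ⟨r', hr, g, hg, hgne, hgN, -⟩ := hypslab hq hf hne φ hφ c hc
      have hr0 : r' = 0 := by omega
      obtain ⟨d, hd⟩ := hg.zero_const hr0
      have hd0 : d ≠ 0 := by
        obtain ⟨x, hx⟩ := hgne
        rwa [hd] at hx
      have hk := finrank_ker1 φ hφ
      rw [← hgN, he1, one_mul]
      have : {x | g x ≠ 0} = Set.univ := by ext x; simp [hd, hd0]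
      rw [Nw, this, Set.ncard_univ, Module.natCard_eq_pow_finrank (K := F), Nat.card_eq_fintype_card, hq]
      congr 1; omega
    · refine Flem hq n V (by omega) s e f hse (by omega) hs (by simpa using hf) hne ?_
      rcases hN with h | h
      · refine lt_of_lt_of_le h (Nat.mul_le_mul_right _ ?_)
        omega
      · exact absurd h.1 he1
  | succ t ih =>
    intro m hT V _ _ _ hV s e n X f hm hse hs he hXs hXq hf hne hN
    have hN' : q * Nw f ≤ (e * q + X) * q ^ n := by
      rcases hN with h | h
      · exact h.le
      · exact h.2
    obtain ⟨φ, hφ, c, hc⟩ := hT m le_rfl V hV (t + 1) s e n X f hm hse hs he (Or.inl (by omega)) hXs hXq hf hN'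
    obtain ⟨r', hr, g, hg, hgne, hgN, -⟩ := hypslab hq hf hne φ hφ c hc
    have hk := finrank_ker1 φ hφ
    rw [← hgN]
    have e1 : (t + 1) * (q - 1) = t * (q - 1) + (q - 1) := by ring
    have e2 : t * (q - 1) + s = r' := by omega
    exact ih (m - 1) (fun m' hm' => hT m' (by omega)) (LinearMap.ker φ) (by omega) s e n X g (by omega)
      hse hs he hXs hXq (by rw [e2]; exact hg) hgne (by rw [hgN]; exact hN)

theorem notInHyp_card [Fintype F] {q : ℕ} (hq : Fintype.card F = q) {f : V → F} (hH : ¬ InHyp f)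
    (hne : ∃ x, f x ≠ 0) (φ : V →ₗ[F] F) (hφ : φ ≠ 0) : (Em f φ).card + 2 ≤ q := by
  classical
  obtain ⟨x, hx⟩ := hne
  have : ∃ y, f y ≠ 0 ∧ φ y ≠ φ x := by
    by_contra! hc
    exact hH ⟨φ, hφ, φ x, hc⟩
  obtain ⟨y, hy, hyx⟩ := this
  have h1 : ({φ x, φ y} : Finset F) ⊆ (Em f φ)ᶜ := by
    intro c hc
    rw [Finset.mem_compl, not_mem_Em]
    simp only [Finset.mem_insert, Finset.mem_singleton] at hc
    rcases hc with rfl | rfl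
    · exact ⟨x, hx, rfl⟩
    · exact ⟨y, hy, rfl⟩
  have h2 := Finset.card_le_card h1
  rw [Finset.card_pair (Ne.symm hyx)] at h2
  have := Finset.card_compl_add_card (Em f φ)
  omega

theorem slabA [Fintype F] [Finite V] {q : ℕ} (hq : Fintype.card F = q) {t s e n k : ℕ} {f : V → F}
    (hV : Module.finrank F V = t + 1 + (n + 1)) (hse : s + e = q) (he : 1 ≤ e)
    (hf : Dg (t * (q - 1) + s) f) (φ : V →ₗ[F] F) (hφ : φ ≠ 0) (hk : (Em f φ).card = k) (hks : k ≤ s)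
    (c : F) (hc : c ∉ Em f φ) : ∃ g : LinearMap.ker φ → F, Dg (t * (q - 1) + (s - k)) g ∧
      (∃ x, g x ≠ 0) ∧ Nw g = Ww f φ c ∧ (e + k) * q ^ n ≤ Ww f φ c ∧
      ∃ p, φ p = c ∧ ∀ w, g w ≠ 0 ↔ f (p + w) ≠ 0 := by
  have hker := finrank_ker1 φ hφ
  obtain ⟨r', hr', g, hg, hgne, hgN, hp⟩ := slab hf φ hφ c hc
  have e1 : r' = t * (q - 1) + (s - k) := by omega
  rw [e1] at hg
  refine ⟨g, hg, hgne, hgN, ?_, hp⟩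
  rw [← hgN]
  exact MD hq _ _ rfl t (s - k) (e + k) n g (by omega) (by omega) (by omega) hg hgne

theorem slabB [Fintype F] [Finite V] {q : ℕ} (hq : Fintype.card F = q) {t s e n b : ℕ} {f : V → F}
    (hV : Module.finrank F V = t + 1 + n) (hse : s + e = q) (hne : ∃ x, f x ≠ 0)
    (hf : Dg (t * (q - 1) + s) f) (φ : V →ₗ[F] F) (hφ : φ ≠ 0) (hk : (Em f φ).card = s + b)
    (hb : 1 ≤ b) (k' : ℕ) (hk' : k' + (Em f φ).card = q) :
    k' * ((b + 1) * q ^ n) ≤ Nw f := by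
  have hker := finrank_ker1 φ hφ
  have hlt := Em_card_lt f φ hne
  have ht : t ≠ 0 := by
    rintro rfl
    obtain ⟨x, hx⟩ := hne
    obtain ⟨r', hr', -⟩ := slab hf φ hφ (φ x) ((not_mem_Em f φ (φ x)).2 ⟨x, hx, rfl⟩)
    omega
  obtain ⟨t, rfl⟩ : ∃ t', t = t' + 1 := ⟨t - 1, by omega⟩
  refine sum_lb f φ _ k' (by omega) ?_
  intro c hc
  obtain ⟨r', hr', g, hg, hgne, hgN, hp⟩ := slab hf φ hφ c hc
  rw [← hgN]
  have e1 : (t + 1) * (q - 1) = t * (q - 1) + (q - 1) := by ring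
  refine MD hq _ _ rfl t (q - 1 - b) (b + 1) n g (by omega) (by omega) (by omega) ?_ hgne
  have : t * (q - 1) + (q - 1 - b) = r' := by omega
  rw [this]; exact hg

theorem exists_kill [Finite V] (h : 2 ≤ Module.finrank F V) (w : V) :
    ∃ φ : V →ₗ[F] F, φ ≠ 0 ∧ φ w = 0 := by
  obtain ⟨φ1, h1⟩ := exists_dual (F := F) (V := V) (by omega)
  by_cases hw : φ1 w = 0
  · exact ⟨φ1, h1, hw⟩
  have hker := finrank_ker1 φ1 h1
  have : Nontrivial (LinearMap.ker φ1) := Module.nontrivial_of_finrank_pos (R := F) (by omega)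
  obtain ⟨v, hv⟩ := exists_ne (0 : LinearMap.ker φ1)
  have hvφ : φ1 v = 0 := LinearMap.mem_ker.1 v.2
  obtain ⟨φ2, h2⟩ : ∃ φ : V →ₗ[F] F, φ v ≠ 0 := by
    by_contra! hc
    exact hv (by simpa using (Module.forall_dual_apply_eq_zero_iff F (v : V)).1 hc)
  refine ⟨φ2 - (φ2 w / φ1 w) • φ1, ?_, ?_⟩
  · intro h0
    apply h2
    have := congrArg (fun φ => φ (v : V)) h0
    simpa [hvφ] using this
  · simp [hw]

theorem T0 [Fintype F] [Finite V] {q : ℕ} (hq : Fintype.card F = q) {t s e X : ℕ} {f : V → F}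
    (hV : Module.finrank F V = t + 1) (hse : s + e = q) (he : 1 ≤ e)
    (hte : 1 ≤ t ∨ e = 1) (hXq : X + 3 ≤ q) (hf : Dg (t * (q - 1) + s) f)
    (hN : q * Nw f ≤ e * q + X) (hne : ∃ x, f x ≠ 0) : InHyp f := by
  classical
  by_contra hH
  have hNe : Nw f ≤ e := by
    by_contra hc
    have := Nat.mul_le_mul_left q (show e + 1 ≤ Nw f by omega)
    rw [mul_add, mul_comm q e] at this
    omega
  by_cases h1 : Nw f ≤ 1
  · obtain ⟨φ, hφ⟩ := exists_dual (F := F) (V := V) (by omega)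
    obtain ⟨x, hx⟩ := hne
    refine hH ⟨φ, hφ, φ x, fun y hy => ?_⟩
    unfold Nw at h1
    rw [Set.ncard_le_one] at h1
    rw [h1 y hy x hx]
  · push Not at h1
    have h1' := h1
    unfold Nw at h1
    rw [Set.one_lt_ncard] at h1
    obtain ⟨p, hp, p', hp', hpp⟩ := h1
    obtain ⟨φ, hφ, hφw⟩ := exists_kill (F := F) (by omega) (p - p')
    have hpφ : φ p = φ p' := by rwa [map_sub, sub_eq_zero] at hφw
    have hk := notInHyp_card hq hH hne φ hφ
    obtain ⟨k', hk'⟩ : ∃ k', k' + (Em f φ).card = q := ⟨q - (Em f φ).card, by omega⟩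
    have h2 : k' < Nw f := by
      rw [← sum_Ww f φ]
      have h3 : (Em f φ)ᶜ.card = k' := by
        have := Finset.card_compl_add_card (Em f φ); omega
      calc k' = ∑ c ∈ (Em f φ)ᶜ, 1 := by simp [h3]
        _ < ∑ c ∈ (Em f φ)ᶜ, Ww f φ c := by
          refine Finset.sum_lt_sum (fun c hc => Ww_pos f φ c (by simpa using hc)) ⟨φ p, ?_, ?_⟩
          · rw [Finset.mem_compl, not_mem_Em]; exact ⟨p, hp, rfl⟩
          · unfold Ww
            rw [Set.one_lt_ncard]
            exact ⟨p, ⟨hp, rfl⟩, p', ⟨hp', hpφ.symm⟩, hpp⟩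
        _ ≤ ∑ c, Ww f φ c := Finset.sum_le_sum_of_subset (Finset.subset_univ _)
    obtain ⟨b, hb⟩ : ∃ b, (Em f φ).card = s + b := ⟨(Em f φ).card - s, by omega⟩
    have h3 := slabB hq (n := 0) (b := b) (by omega) hse hne hf φ hφ hb (by omega) k' hk'
    simp only [pow_zero, mul_one] at h3
    obtain ⟨a, rfl⟩ : ∃ a, k' = a + 2 := ⟨k' - 2, by omega⟩
    have h4 : (a + 2) * (b + 1) ≤ a + 2 + b := by omega
    have : 1 ≤ b := by omega
    nlinarith [Nat.zero_le (a * b)]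

theorem cover [Fintype F] [Finite V] {q r k : ℕ} (hq : Fintype.card F = q) {f : V → F} (hf : Dg r f)
    (φ ψ : V →ₗ[F] F) (d : F) (hk : (Em f φ).card = k)
    (B : Finset F) (c : F) (hc : c ∉ Em f φ) (hcB : c ∉ B) (hBE : ∀ b ∈ B, b ∉ Em f φ)
    (hB : ∀ x, f x ≠ 0 → φ x ∈ B → ψ x = d)
    (hmin : ∀ g : V → F, Dg (r + q - k - B.card) g → (∃ x, g x ≠ 0) → Ww f φ c < Nw g ∨
      (Ww f φ c ≤ Nw g ∧ ∃ p, f p ≠ 0 ∧ φ p = c ∧ ψ p = d)) :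
    ∀ x, f x ≠ 0 → φ x = c → ψ x = d := by
  classical
  intro x hx hxc
  by_contra hxd
  obtain ⟨j, hj, g, hg, hgs⟩ := iso hf φ ψ d B c hc hcB
    (Finset.disjoint_left.2 hBE) hB
  have e1 : r + 1 + j = r + q - k - B.card := by omega
  rw [e1] at hg
  have hsub : {x | g x ≠ 0} ⊆ {x | f x ≠ 0 ∧ φ x = c} := by
    intro y hy
    have := (hgs y).1 hy
    exact ⟨this.1, this.2.1⟩
  rcases hmin g hg ⟨x, (hgs x).2 ⟨hx, hxc, hxd⟩⟩ with h | ⟨h, p, hp, hpc, hpd⟩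
  · have : Nw g ≤ Ww f φ c := Set.ncard_le_ncard hsub (Set.toFinite _)
    omega
  · have : Nw g < Ww f φ c := by
      refine Set.ncard_lt_ncard ⟨hsub, fun h' => ?_⟩ (Set.toFinite _)
      have := (hgs p).1 (h' (a := p) ⟨hp, hpc⟩)
      exact this.2.2 hpd
    omega

theorem sum_lb1 [Fintype F] [Finite V] {q : ℕ} (hq : Fintype.card F = q) (f : V → F) (φ : V →ₗ[F] F)
    (v k'' : ℕ) (hk : k'' + 1 + (Em f φ).card = q) (h : ∀ c, c ∉ Em f φ → v ≤ Ww f φ c)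
    (c : F) (hc : c ∉ Em f φ) : Ww f φ c + k'' * v ≤ Nw f := by
  classical
  rw [← sum_Ww f φ, ← Finset.add_sum_erase _ _ (Finset.mem_univ c)]
  have h1 : ((Em f φ)ᶜ.erase c).card = k'' := by
    have := Finset.card_compl_add_card (Em f φ)
    rw [Finset.card_erase_of_mem (by simpa using hc)]; omega
  gcongr
  calc k'' * v = ∑ c ∈ (Em f φ)ᶜ.erase c, v := by simp [h1]
    _ ≤ ∑ c ∈ (Em f φ)ᶜ.erase c, Ww f φ c := Finset.sum_le_sum fun c hc => h c (by
        have := Finset.mem_of_mem_erase hc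
        simpa using this)
    _ ≤ _ := Finset.sum_le_sum_of_subset (Finset.erase_subset_erase _ (Finset.subset_univ _))

theorem choose_l {φ φ0 : V →ₗ[F] F} {c1 c0 : F} (p2 : V) (h : φ p2 ≠ c1) :
    ∃ l : F, (φ0 + l • φ) p2 = c0 + l * c1 := by
  have h' : c1 - φ p2 ≠ 0 := sub_ne_zero.2 (Ne.symm h)
  refine ⟨(φ0 p2 - c0) / (c1 - φ p2), ?_⟩
  simp only [LinearMap.add_apply, LinearMap.smul_apply, smul_eq_mul]
  field_simp
  ring

theorem claim1 [Fintype F] [Finite V] {q : ℕ} (hq : Fintype.card F = q) {t s e n X : ℕ} {f : V → F}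
    (hV : Module.finrank F V = t + 1 + (n + 1)) (hT : ∀ m' < t + 1 + (n + 1), TT F q m')
    (hse : s + e = q) (he : 1 ≤ e) (hte : 1 ≤ t ∨ e = 1) (hXs : X + 1 ≤ s)
    (hXq : X + 3 ≤ q) (hf : Dg (t * (q - 1) + s) f) (hN : Nw f ≤ (e * q + X) * q ^ n)
    (hne : ∃ x, f x ≠ 0) (hH : ¬ InHyp f) (φ : V →ₗ[F] F) (hφ : φ ≠ 0) : (Em f φ).card = 0 := by
  classical
  by_contra hk0
  obtain ⟨k, hk⟩ : ∃ k, (Em f φ).card = k := ⟨_, rfl⟩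
  have hk2 := notInHyp_card hq hH hne φ hφ
  have hker := finrank_ker1 φ hφ
  have hQ : 0 < q ^ n := Nat.pow_pos (by omega)
  obtain ⟨k'', hk''⟩ : ∃ k'', k'' + 2 + k = q := ⟨q - k - 2, by omega⟩
  by_cases hks : s < k
  · obtain ⟨b, rfl⟩ : ∃ b, k = s + (b + 1) := ⟨k - s - 1, by omega⟩
    have h3 := slabB hq (n := n + 1) hV hse hne hf φ hφ hk (by omega) (k'' + 2) (by omega)
    have h4 := h3.trans hN
    have : (k'' + 2) * ((b + 1 + 1) * q ^ (n + 1)) = (k'' + 2) * (b + 1 + 1) * q * q ^ n := by ring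
    rw [this] at h4
    have h5 := Nat.le_of_mul_le_mul_right h4 hQ
    have e1 : e = k'' + 2 + (b + 1) := by omega
    have h6 : (e + 1) * q ≤ (k'' + 2) * (b + 1 + 1) * q := by
      refine Nat.mul_le_mul_right _ ?_
      rw [e1]
      nlinarith [Nat.zero_le (k'' * b)]
    rw [add_mul] at h6
    omega
  · have hsl := fun c hc => slabA hq hV hse he hf φ hφ hk (by omega) c hc
    have hlow : ∀ c, c ∉ Em f φ → (e + k) * q ^ n ≤ Ww f φ c := by
      intro c hc
      obtain ⟨g, -, -, -, h, -⟩ := hsl c hc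
      exact h
    have hup := sum_lb1 hq f φ _ (k'' + 1) (by omega) hlow
    have main : ∀ c, c ∉ Em f φ → Ww f φ c = (e + k) * q ^ n ∧
        ∃ φ0 : V →ₗ[F] F, ∃ c0, (∀ l : F, φ0 + l • φ ≠ 0) ∧ ∀ x, f x ≠ 0 → φ x = c → φ0 x = c0 := by
      intro c hc
      obtain ⟨g, hg, hgne, hgN, hgl, p, hp, hgp⟩ := hsl c hc
      have hu := (hup c hc).trans hN
      by_cases hks' : k < s
      · obtain ⟨b, rfl⟩ : ∃ b, s = k + 1 + b := ⟨s - k - 1, by omega⟩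
        obtain ⟨j, rfl⟩ : ∃ j, k = j + 1 := ⟨k - 1, by omega⟩
        have e1 : k'' + 2 = e + b + 1 := by omega
        have e2 : (k'' + 2) * (e + (j + 1)) = e * q + (j + 1) * (b + 1) := by
          rw [e1, ← hse]; ring
        have e3 : X ≤ (j + 1) * (b + 1) := by nlinarith [Nat.zero_le (j * b)]
        have hW : Ww f φ c = (e + (j + 1)) * q ^ n := by
          refine le_antisymm ?_ (hlow c hc)
          have h1 : (e * q + X) * q ^ n ≤ (k'' + 2) * (e + (j + 1)) * q ^ n := by
            refine Nat.mul_le_mul_right _ ?_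
            omega
          have e4 : (k'' + 2) * (e + (j + 1)) * q ^ n = (k'' + 1) * ((e + (j + 1)) * q ^ n) +
            (e + (j + 1)) * q ^ n := by ring
          omega
        refine ⟨hW, ?_⟩
        have hX : j + 1 + b ≤ X := by
          have h1 := (Nat.add_le_add_right (hlow c hc) ((k'' + 1) * ((e + (j + 1)) * q ^ n))).trans hu
          have e4 : (k'' + 2) * (e + (j + 1)) * q ^ n = (e + (j + 1)) * q ^ n +
            (k'' + 1) * ((e + (j + 1)) * q ^ n) := by ring
          rw [← e4] at h1
          have h2 := Nat.le_of_mul_le_mul_right h1 hQ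
          rw [e2] at h2
          nlinarith [Nat.zero_le (j * b)]
        refine slabHyp hp hgp (hT (t + 1 + n) (by omega) _ (by omega) t (j + 1 + 1 + b - (j + 1)) (e + (j + 1)) n 0 g
          rfl (by omega) (by omega) (by omega) (Or.inl (by omega)) (by omega) (by omega) hg ?_)
        rw [hgN, hW]
        apply le_of_eq; ring
      · have hks'' : k = s := by omega
        subst hks''
        have ht : 1 ≤ t := by omega
        obtain ⟨t, rfl⟩ : ∃ t', t = t' + 1 := ⟨t - 1, by omega⟩
        have e0 : e + k = q := by omega
        have hWle : q * Ww f φ c ≤ (1 * q + X) * q ^ (n + 1) := by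
          have : Ww f φ c ≤ (q + X) * q ^ n := by
            have e1 : e = k'' + 2 := by omega
            rw [e0, e1] at hu
            nlinarith
          calc q * Ww f φ c ≤ q * ((q + X) * q ^ n) := Nat.mul_le_mul_left _ this
            _ = _ := by ring
        have e1 : (t + 1) * (q - 1) + (k - k) = t * (q - 1) + (q - 1) := by
          rw [Nat.sub_self]; ring
        rw [e1] at hg
        have hW : Nw g = 1 * q ^ (n + 1) := Glem hq t (t + 1 + (n + 1)) (fun m' hm' => hT m' (by omega))
          (LinearMap.ker φ) (by omega) (q - 1) 1 (n + 1) X g rfl (by omega) (by omega) le_rfl (by omega)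
          hXq hg hgne (Or.inr ⟨rfl, by rw [hgN]; exact hWle⟩)
        refine ⟨?_, ?_⟩
        · rw [← hgN, hW, e0]; ring
        · exact slabHyp hp hgp (hT (t + 1 + (n + 1)) (by omega) _ (by omega) t (q - 1) 1 (n + 1) X g
            rfl (by omega) (by omega) le_rfl (Or.inr rfl) (by omega) hXq hg (by rw [hgN]; exact hWle))
    obtain ⟨x1, hx1⟩ := hne
    have hc1 : φ x1 ∉ Em f φ := (not_mem_Em f φ _).2 ⟨x1, hx1, rfl⟩
    obtain ⟨-, φ0, c0, hφ0, hcov⟩ := main _ hc1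
    obtain ⟨x2, hx2, hx12⟩ : ∃ y, f y ≠ 0 ∧ φ y ≠ φ x1 := by
      by_contra! hc
      exact hH ⟨φ, hφ, φ x1, hc⟩
    have hc2 : φ x2 ∉ Em f φ := (not_mem_Em f φ _).2 ⟨x2, hx2, rfl⟩
    obtain ⟨l, hl⟩ := choose_l (φ0 := φ0) (c0 := c0) x2 hx12
    have k1 : ∀ x, f x ≠ 0 → φ x = φ x1 → (φ0 + l • φ) x = c0 + l * φ x1 := by
      intro x hx hxx
      simp [hcov x hx hxx, hxx]
    have k2 : ∀ x, f x ≠ 0 → φ x = φ x2 → (φ0 + l • φ) x = c0 + l * φ x1 := by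
      refine cover hq hf φ _ _ hk {φ x1} (φ x2) hc2 (by simpa using hx12) ?_ ?_ ?_
      · intro b hb; rw [Finset.mem_singleton] at hb; rw [hb]; exact hc1
      · intro x hx hxx; exact k1 x hx (by simpa using hxx)
      · intro g hg hgne
        refine Or.inr ⟨?_, x2, hx2, rfl, hl⟩
        rw [(main _ hc2).1]
        refine MD hq _ V hV (t + 1) (s - k) (e + k) n g (by omega) (by omega) (by omega) ?_ hgne
        convert hg using 1
        have : (t + 1) * (q - 1) = t * (q - 1) + (q - 1) := by ring
        rw [Finset.card_singleton]
        omega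
    refine hH ⟨φ0 + l • φ, hφ0 l, c0 + l * φ x1, fun x hx => ?_⟩
    by_cases hxx1 : φ x = φ x1
    · exact k1 x hx hxx1
    by_cases hxx2 : φ x = φ x2
    · exact k2 x hx hxx2
    have hcx : φ x ∉ Em f φ := (not_mem_Em f φ _).2 ⟨x, hx, rfl⟩
    refine cover hq hf φ _ _ hk {φ x1, φ x2} (φ x) hcx (by simp [hxx1, hxx2]) ?_ ?_ ?_ x hx rfl
    · intro b hb
      simp only [Finset.mem_insert, Finset.mem_singleton] at hb
      rcases hb with rfl | rfl
      · exact hc1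
      · exact hc2
    · intro y hy hyy
      simp only [Finset.mem_insert, Finset.mem_singleton] at hyy
      rcases hyy with h | h
      · exact k1 y hy h
      · exact k2 y hy h
    · intro g hg hgne
      left
      rw [(main _ hcx).1]
      rw [Finset.card_pair (Ne.symm hx12)] at hg
      by_cases hks' : k < s
      · refine lt_of_lt_of_le ?_ (MD hq _ V hV (t + 1) (s - k - 1) (e + k + 1) n g (by omega) (by omega)
          (by omega) ?_ hgne)
        · exact Nat.mul_lt_mul_of_pos_right (by omega) hQ
        convert hg using 1
        have : (t + 1) * (q - 1) = t * (q - 1) + (q - 1) := by ring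
        omega
      · refine lt_of_lt_of_le ?_ (MD hq _ V hV t (q - 2) 2 (n + 1) g (by omega) (by omega)
          (by omega) ?_ hgne)
        · have e0 : e + k = q := by omega
          rw [e0, pow_succ]
          nlinarith [Nat.mul_pos (show 0 < q by omega) hQ]
        convert hg using 1
        omega

theorem sum3 [Fintype F] [DecidableEq F] [Finite V] {q : ℕ} (hq : Fintype.card F = q) (f : V → F)
    (φ : V →ₗ[F] F) (M v w u : ℕ) (A : Finset F) (c : F) (hcA : c ∉ A) (h0 : ∀ d, v ≤ M * Ww f φ d)
    (hA : ∀ d ∈ A, v + w ≤ M * Ww f φ d) (hc : v + u ≤ M * Ww f φ c) :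
    q * v + A.card * w + u ≤ M * Nw f := by
  rw [← sum_Ww f φ, Finset.mul_sum]
  calc q * v + A.card * w + u = ∑ d : F, (v + ((if d ∈ A then w else 0) + (if d = c then u else 0))) := by
        rw [Finset.sum_add_distrib, Finset.sum_add_distrib]
        simp [hq]; ring
    _ ≤ _ := by
      refine Finset.sum_le_sum fun d _ => ?_
      by_cases hd : d = c
      · subst hd; simp [hcA]; exact hc
      · by_cases hdA : d ∈ A
        · simp [hd, hdA]; exact hA d hdA
        · simp [hd, hdA]; exact h0 d

theorem sum_sub [Fintype F] [Finite V] (f : V → F) (φ ψ : V →ₗ[F] F) (d : F) (J : Finset F)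
    (h : ∀ x, f x ≠ 0 → φ x ∈ J → ψ x = d) : ∑ c ∈ J, Ww f φ c ≤ Ww f ψ d := by
  classical
  let f' : V → F := fun x => if ψ x = d then f x else 0
  have h1 : Nw f' = Ww f ψ d := by
    unfold Nw Ww
    congr 1
    ext x
    simp only [f', Set.mem_ofPred_eq]
    split_ifs with hx <;> simp [hx]
  rw [← h1, ← sum_Ww f' φ]
  refine le_trans ?_ (Finset.sum_le_sum_of_subset (Finset.subset_univ J))
  refine Finset.sum_le_sum fun c hc => ?_
  refine Set.ncard_le_ncard ?_ (Set.toFinite _)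
  rintro x ⟨hx, rfl⟩
  refine ⟨?_, rfl⟩
  simp only [f', h x hx hc, if_true]; exact hx

theorem card_two [Fintype F] [DecidableEq F] {q : ℕ} (hq : Fintype.card F = q) (p : F → Prop) [DecidablePred p]
    (h : ¬ ∃ i j, i ≠ j ∧ p i ∧ p j) (d : F) :
    q ≤ ((Finset.univ.filter (fun c => ¬ p c)).erase d).card + 2 := by
  have h1 : (Finset.univ.filter p).card ≤ 1 := by
    rw [Finset.card_le_one]
    intro a ha b hb
    by_contra hab
    simp only [Finset.mem_filter, Finset.mem_univ, true_and] at ha hb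
    exact h ⟨a, b, hab, ha, hb⟩
  have h2 := Finset.card_filter_add_card_filter_not (s := (Finset.univ : Finset F)) p
  have h3 := Finset.pred_card_le_card_erase (a := d) (s := Finset.univ.filter (fun c => ¬ p c))
  rw [Finset.card_univ, hq] at h2
  omega

set_option maxHeartbeats 2000000 in
theorem claim2 [Fintype F] [Finite V] {q : ℕ} (hq : Fintype.card F = q) {t s e n X : ℕ} {f : V → F}
    (hV : Module.finrank F V = t + 1 + (n + 1)) (hT : ∀ m' < t + 1 + (n + 1), TT F q m')
    (hse : s + e = q) (hs : 1 ≤ s) (he : 1 ≤ e) (hte : 1 ≤ t ∨ e = 1) (hXs : X + 1 ≤ s)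
    (hXq : X + 3 ≤ q) (hf : Dg (t * (q - 1) + s) f) (hN : Nw f ≤ (e * q + X) * q ^ n)
    (hE : ∀ φ : V →ₗ[F] F, φ ≠ 0 → (Em f φ).card = 0) : False := by
  classical
  have hQ : 0 < q ^ n := Nat.pow_pos (by omega)
  have hEm : ∀ φ : V →ₗ[F] F, φ ≠ 0 → ∀ c, c ∉ Em f φ := by
    intro φ hφ c
    rw [Finset.card_eq_zero.1 (hE φ hφ)]; simp
  have hsl := fun (φ : V →ₗ[F] F) (hφ : φ ≠ 0) c =>
    slabA hq hV hse he hf φ hφ (hE φ hφ) (Nat.zero_le _) c (hEm φ hφ c)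
  simp only [Nat.sub_zero, add_zero] at hsl
  have fa : ∀ φ : V →ₗ[F] F, φ ≠ 0 → ∀ c, e * q ^ n ≤ Ww f φ c := by
    intro φ hφ c
    obtain ⟨g, -, -, -, h, -⟩ := hsl φ hφ c
    exact h
  have fb : ∀ φ : V →ₗ[F] F, φ ≠ 0 → ∀ c, ¬ Ww f φ c = e * q ^ n →
      (e * q + X) * q ^ n ≤ q * Ww f φ c := by
    intro φ hφ c hne
    obtain ⟨g, hg, hgne, hgN, h, -⟩ := hsl φ hφ c
    have hker := finrank_ker1 φ hφ
    by_contra! hc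
    apply hne
    rw [← hgN]
    exact Glem hq t (t + 1 + n) (fun m' hm' => hT m' (by omega)) (LinearMap.ker φ) (by omega) s e n X g
      rfl hse hs he hXs hXq hg hgne (Or.inl (by rw [hgN]; exact hc))
  have fc : ∀ φ : V →ₗ[F] F, φ ≠ 0 → ∀ c, q * Ww f φ c ≤ (e * q + X) * q ^ n →
      ∃ φ0 : V →ₗ[F] F, ∃ c0, (∀ l : F, φ0 + l • φ ≠ 0) ∧ ∀ x, f x ≠ 0 → φ x = c → φ0 x = c0 := by
    intro φ hφ c hle
    obtain ⟨g, hg, hgne, hgN, h, p, hp, hgp⟩ := hsl φ hφ c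
    have hker := finrank_ker1 φ hφ
    exact slabHyp hp hgp (hT (t + 1 + n) (by omega) _ (by omega) t s e n X g
          rfl hse hs he hte hXs hXq hg (by rw [hgN]; exact hle))
  have fd : q * (e * q ^ n) ≤ (e * q + X) * q ^ n := by nlinarith [Nat.zero_le (X * q ^ n)]
  -- ascent
  have asc : ∀ j, ∀ φ : V →ₗ[F] F, φ ≠ 0 →
      q + 1 ≤ (Finset.univ.filter (fun c => Ww f φ c < (e + 1) * q ^ n)).card + j →
      (∃ i1 i2, i1 ≠ i2 ∧ Ww f φ i1 = e * q ^ n ∧ Ww f φ i2 = e * q ^ n) → False := by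
    intro j
    induction j with
    | zero =>
      intro φ hφ h _
      have := Finset.card_le_univ (Finset.univ.filter (fun c => Ww f φ c < (e + 1) * q ^ n))
      omega
    | succ j ih =>
      intro φ hφ hj hI
      obtain ⟨i1, i2, h12, hi1, hi2⟩ := hI
      obtain ⟨J, hJ⟩ : ∃ J, J = Finset.univ.filter (fun c => Ww f φ c < (e + 1) * q ^ n) := ⟨_, rfl⟩
      rw [← hJ] at hj
      have hJm : ∀ c, c ∈ J ↔ Ww f φ c < (e + 1) * q ^ n := by intro c; simp [hJ]
      have hlt : e * q ^ n < (e + 1) * q ^ n := by nlinarith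
      have hi1J : i1 ∈ J := (hJm _).2 (by omega)
      have hi2J : i2 ∈ J := (hJm _).2 (by omega)
      have hJ3 : 3 ≤ J.card := by
        have h1 := sum3 hq f φ 1 (e * q ^ n) (q ^ n) 0 Jᶜ i1 (by simpa using hi1J)
          (by simpa using fa φ hφ) (by
            intro d hd
            rw [Finset.mem_compl, hJm] at hd
            nlinarith) (by simpa using fa φ hφ i1)
        have h2 : Jᶜ.card * q ^ n ≤ X * q ^ n := by nlinarith
        have h3 := Nat.le_of_mul_le_mul_right h2 hQ
        have := Finset.card_compl_add_card J
        omega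
      obtain ⟨φ0, c0, hφ0, hcov⟩ := fc φ hφ i1 (by rw [hi1]; exact fd)
      obtain ⟨p2, hp2, hp2i⟩ := (not_mem_Em f φ i2).1 (hEm φ hφ i2)
      obtain ⟨l, hl⟩ := choose_l (φ := φ) (φ0 := φ0) (c1 := i1) (c0 := c0) p2 (by rw [hp2i]; exact h12.symm)
      have k1 : ∀ x, f x ≠ 0 → φ x = i1 → (φ0 + l • φ) x = c0 + l * i1 := by
        intro x hx hxx
        simp [hcov x hx hxx, hxx]
      have k2 : ∀ x, f x ≠ 0 → φ x = i2 → (φ0 + l • φ) x = c0 + l * i1 := by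
        refine cover hq hf φ _ _ (hE φ hφ) {i1} i2 (hEm φ hφ i2) (by simpa using h12.symm) ?_ ?_ ?_
        · intro b hb; exact hEm φ hφ b
        · intro x hx hxx; exact k1 x hx (by simpa using hxx)
        · intro g hg hgne
          refine Or.inr ⟨?_, p2, hp2, hp2i, hl⟩
          rw [hi2]
          refine MD hq _ V hV (t + 1) s e n g (by omega) (by omega) (by omega) ?_ hgne
          convert hg using 1
          have : (t + 1) * (q - 1) = t * (q - 1) + (q - 1) := by ring
          rw [Finset.card_singleton]
          omega
      have k3 : ∀ x, f x ≠ 0 → φ x ∈ J → (φ0 + l • φ) x = c0 + l * i1 := by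
        intro x hx hxJ
        by_cases hxx1 : φ x = i1
        · exact k1 x hx hxx1
        by_cases hxx2 : φ x = i2
        · exact k2 x hx hxx2
        refine cover hq hf φ _ _ (hE φ hφ) {i1, i2} (φ x) (hEm φ hφ _) (by simp [hxx1, hxx2]) ?_ ?_ ?_ x hx rfl
        · intro b hb; exact hEm φ hφ b
        · intro y hy hyy
          simp only [Finset.mem_insert, Finset.mem_singleton] at hyy
          rcases hyy with h | h
          · exact k1 y hy h
          · exact k2 y hy h
        · intro g hg hgne
          left
          rw [Finset.card_pair h12] at hg
          refine lt_of_lt_of_le ((hJm _).1 hxJ) (MD hq _ V hV (t + 1) (s - 1) (e + 1) n g (by omega) (by omega)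
            (by omega) ?_ hgne)
          convert hg using 1
          have : (t + 1) * (q - 1) = t * (q - 1) + (q - 1) := by ring
          omega
      set ψ := φ0 + l • φ with hψ
      set d := c0 + l * i1 with hd
      have hψ0 : ψ ≠ 0 := hφ0 l
      have hWK : J.card * (e * q ^ n) ≤ Ww f ψ d := by
        refine le_trans ?_ (sum_sub f φ ψ d J k3)
        calc J.card * (e * q ^ n) = ∑ c ∈ J, e * q ^ n := by simp
          _ ≤ _ := Finset.sum_le_sum fun c _ => fa φ hφ c
      obtain ⟨y, hy⟩ : ∃ y, J.card = y + 3 := ⟨J.card - 3, by omega⟩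
      rw [hy] at hWK hj
      have hWK1 : e * q ^ n + (y + 2) * e * q ^ n ≤ Ww f ψ d := by
        refine le_trans (le_of_eq ?_) hWK; ring
      refine ih ψ hψ0 ?_ ?_
      · obtain ⟨J', hJ'⟩ : ∃ J, J = Finset.univ.filter (fun c => Ww f ψ c < (e + 1) * q ^ n) := ⟨_, rfl⟩
        rw [← hJ']
        have hJm' : ∀ c, c ∈ J' ↔ Ww f ψ c < (e + 1) * q ^ n := by intro c; simp [hJ']
        have h1 := sum3 hq f ψ 1 (e * q ^ n) (q ^ n) ((y + 2) * e * q ^ n) (J'ᶜ.erase d) d (by simp)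
          (by simpa using fa ψ hψ0) (by
            intro d hd
            have hd := Finset.mem_of_mem_erase hd
            rw [Finset.mem_compl, hJm'] at hd
            nlinarith) (by simpa using hWK1)
        have h2 : ((J'ᶜ.erase d).card + (y + 2) * e) * q ^ n ≤ X * q ^ n := by nlinarith
        have h3 := Nat.le_of_mul_le_mul_right h2 hQ
        have h4 := Finset.card_compl_add_card J'
        have h5 := Finset.pred_card_le_card_erase (a := d) (s := J'ᶜ)
        have h6 : y + 2 ≤ (y + 2) * e := Nat.le_mul_of_pos_right _ he
        omega
      · by_contra hc
        have h0 := card_two hq (fun c => Ww f ψ c = e * q ^ n) hc d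
        have h1 := sum3 hq f ψ q (q * (e * q ^ n)) (X * q ^ n) (q * ((y + 2) * e * q ^ n))
          ((Finset.univ.filter (fun c => ¬ Ww f ψ c = e * q ^ n)).erase d) d (by simp)
          (fun d => Nat.mul_le_mul_left _ (fa ψ hψ0 d)) (by
            intro d hd
            have hd := Finset.mem_of_mem_erase hd
            simp only [Finset.mem_filter, Finset.mem_univ, true_and] at hd
            refine le_trans (le_of_eq ?_) (fb ψ hψ0 d hd)
            ring) (by rw [← mul_add]; exact Nat.mul_le_mul_left _ hWK1)
        obtain ⟨A, hA⟩ : ∃ A, ((Finset.univ.filter (fun c => ¬ Ww f ψ c = e * q ^ n)).erase d).card = A := ⟨_, rfl⟩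
        rw [hA] at h0 h1
        have h2 := h1.trans (Nat.mul_le_mul_left q hN)
        have h3 : (A * X + q * ((y + 2) * e)) * q ^ n ≤ (q * X) * q ^ n := by nlinarith
        have h4 := Nat.le_of_mul_le_mul_right h3 hQ
        have h5 : q * X ≤ (A + 2) * X := Nat.mul_le_mul_right _ h0
        have h6 : q * 2 ≤ q * ((y + 2) * e) := Nat.mul_le_mul_left _
          (le_trans (by omega) (Nat.le_mul_of_pos_right (y + 2) he))
        rw [add_mul] at h5
        omega
  obtain ⟨φ, hφ⟩ := exists_dual (F := F) (V := V) (by omega)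
  obtain ⟨c1, hc1⟩ : ∃ c, q * Ww f φ c ≤ Nw f := by
    by_contra! hc
    have h3 : ∑ c : F, Nw f < ∑ c : F, q * Ww f φ c :=
      Finset.sum_lt_sum_of_nonempty Finset.univ_nonempty (fun l _ => hc l)
    rw [← Finset.mul_sum, sum_Ww] at h3
    simp [hq] at h3
  obtain ⟨φ0, c0, hφ0, hcov⟩ := fc φ hφ c1 (hc1.trans hN)
  obtain ⟨l, hl⟩ := pencil f φ φ0 c1 c0 hcov
  set ψ := φ0 + l • φ with hψ
  set d := c0 + l * c1 with hd
  have hψ0 : ψ ≠ 0 := hφ0 l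
  refine asc (q + 1) ψ hψ0 (by omega) ?_
  by_contra hc
  have h0 := card_two hq (fun c => Ww f ψ c = e * q ^ n) hc d
  have hNl : q * (e * q ^ n) ≤ Nw f := by
    have := sum_lb f ψ (e * q ^ n) q (by rw [hE ψ hψ0, hq]; rfl) (fun c _ => fa ψ hψ0 c)
    exact this
  obtain ⟨Y, hY⟩ : ∃ Y, Nw f = q * (e * q ^ n) + Y := ⟨Nw f - q * (e * q ^ n), by omega⟩
  obtain ⟨q', hq'⟩ : ∃ q', q = q' + 2 := ⟨q - 2, by omega⟩
  have h1 := sum3 hq f ψ q (q * (e * q ^ n)) (X * q ^ n) ((q' + 1) * (e * q ^ n) + Y)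
    ((Finset.univ.filter (fun c => ¬ Ww f ψ c = e * q ^ n)).erase d) d (by simp)
    (fun d => Nat.mul_le_mul_left _ (fa ψ hψ0 d)) (by
      intro d hd
      have hd := Finset.mem_of_mem_erase hd
      simp only [Finset.mem_filter, Finset.mem_univ, true_and] at hd
      refine le_trans (le_of_eq ?_) (fb ψ hψ0 d hd)
      ring) (by
      rw [hq, hY] at hl
      have h2 := fa φ hφ c1
      have h3 : q * Ww f φ c1 = (q' + 1) * Ww f φ c1 + Ww f φ c1 := by rw [hq']; ring
      have h4 := Nat.mul_le_mul_left (q' + 1) h2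
      omega)
  obtain ⟨A, hA⟩ : ∃ A, ((Finset.univ.filter (fun c => ¬ Ww f ψ c = e * q ^ n)).erase d).card = A := ⟨_, rfl⟩
  rw [hA] at h0 h1
  obtain ⟨E, hEE⟩ : ∃ E, E = e * q ^ n := ⟨_, rfl⟩
  have hYX : Y ≤ X * q ^ n := by
    rw [hY] at hN
    have : (e * q + X) * q ^ n = q * (e * q ^ n) + X * q ^ n := by ring
    omega
  rw [hY] at h1
  have h2 : A * (X * q ^ n) + (q' + 1) * (e * q ^ n) + Y ≤ q * Y := by
    rw [mul_add] at h1; omega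
  have h3 : q' * (X * q ^ n) ≤ A * (X * q ^ n) := Nat.mul_le_mul_right _ (by omega)
  have h4 : q * Y = (q' + 1) * Y + Y := by rw [hq']; ring
  have h5 : (q' + 1) * Y ≤ (q' + 1) * (X * q ^ n) := Nat.mul_le_mul_left _ hYX
  have h6 : (q' + 1) * (X * q ^ n) = q' * (X * q ^ n) + X * q ^ n := by ring
  have h7 : ((q' + 1) * e) * q ^ n ≤ X * q ^ n := by
    have : (q' + 1) * (e * q ^ n) = ((q' + 1) * e) * q ^ n := by ring
    omega
  have h8 := Nat.le_of_mul_le_mul_right h7 hQ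
  nlinarith

theorem Tall [Fintype F] {q : ℕ} (hq : Fintype.card F = q) (m : ℕ) : TT F q m := by
  induction m using Nat.strong_induction_on with
  | _ m ih =>
  intro V _ _ _ hV t s e n X f hm hse hs he hte hXs hXq hf hN
  by_cases hne : ∃ x, f x ≠ 0
  · cases n with
    | zero => exact T0 hq (by omega) hse he hte hXq hf (by simpa using hN) hne
    | succ n =>
      by_contra hH
      have hN' : Nw f ≤ (e * q + X) * q ^ n := by
        have : (e * q + X) * q ^ (n + 1) = q * ((e * q + X) * q ^ n) := by ring
        rw [this] at hN
        exact Nat.le_of_mul_le_mul_left hN (by omega)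
      subst hm
      exact claim2 hq hV ih hse hs he hte hXs hXq hf hN'
        (claim1 hq hV ih hse he hte hXs hXq hf hN' hne hH)
  · push Not at hne
    obtain ⟨φ, hφ⟩ := exists_dual (F := F) (V := V) (by omega)
    exact ⟨φ, hφ, 0, fun x hx => absurd (hne x) hx⟩

theorem final [Fintype F] {q : ℕ} (hq : Fintype.card F = q) {s e n : ℕ} (hse : s + e = q) (hs : 1 ≤ s)
    (he : 2 ≤ e) : ∀ (t : ℕ) (V : Type) [AddCommGroup V] [Module F V] [Finite V],
    Module.finrank F V = t + 1 + n → ∀ (f : V → F), Dg (t * (q - 1) + s) f → (∃ x, f x ≠ 0) →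
    q * Nw f ≤ (e * q + (s - 1)) * q ^ n →
    ∃ (D : Submodule F V) (p : V), Module.finrank F D = 1 + n ∧ ∀ x, f x ≠ 0 → x - p ∈ D := by
  intro t
  induction t with
  | zero =>
    intro V _ _ _ hV f hf hne hN
    exact ⟨⊤, 0, by rw [finrank_top]; omega, by simp⟩
  | succ t ih =>
    intro V _ _ _ hV f hf hne hN
    obtain ⟨φ, hφ, c, hc⟩ := Tall hq _ V hV (t + 1) s e n (s - 1) f rfl hse hs (by omega)
      (Or.inl (by omega)) (by omega) (by omega) hf hN
    obtain ⟨r', hr, g, hg, hgne, hgN, p, hp, hgp⟩ := hypslab hq hf hne φ hφ c hc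
    have hk := finrank_ker1 φ hφ
    have e1 : (t + 1) * (q - 1) = t * (q - 1) + (q - 1) := by ring
    have e2 : t * (q - 1) + s = r' := by omega
    obtain ⟨D, p', hD, hDp⟩ := ih (LinearMap.ker φ) (by omega) g (by rw [e2]; exact hg) hgne
      (by rw [hgN]; exact hN)
    refine ⟨D.map (LinearMap.ker φ).subtype, p + p', ?_, ?_⟩
    · rw [← hD]
      exact Submodule.finrank_map_subtype_eq _ _
    · intro x hx
      have hxk : x - p ∈ LinearMap.ker φ := by
        rw [LinearMap.mem_ker, map_sub, hc x hx, hp, sub_self]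
      have := hDp ⟨x - p, hxk⟩ ((hgp _).2 (by simpa using hx))
      refine ⟨_, this, ?_⟩
      simp [sub_sub]

theorem Dg_of_poly {m r : ℕ} (P : MvPolynomial (Fin m) F) (h : P.totalDegree ≤ r) :
    Dg r (fun x : Fin m → F => MvPolynomial.eval x P) := by
  classical
  have hmon : ∀ (k : ℕ) (d : Fin m →₀ ℕ) , (d.sum fun _ e => e) = k → 
      Dg k (fun x : Fin m → F => ∏ i, x i ^ d i) := by
    intro k
    induction k with
    | zero =>
      intro d hd
      have : d = 0 := by
        ext i
        rw [Finsupp.sum_fintype _ _ (by simp)] at hd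
        have := (Finset.sum_eq_zero_iff.1 hd) i (Finset.mem_univ _)
        simpa using this
      subst this
      simpa using Dg.const 0 1
    | succ k ih =>
      intro d hd
      rw [Finsupp.sum_fintype _ _ (by simp)] at hd
      obtain ⟨i, -, hi⟩ : ∃ i ∈ Finset.univ, d i ≠ 0 := Finset.exists_ne_zero_of_sum_ne_zero (by omega)
      have hd' : d = (d - Finsupp.single i 1) + Finsupp.single i 1 := by
        ext j
        by_cases hj : j = i
        · subst hj; simp; omega
        · simp [hj, Finsupp.single_apply, Ne.symm hj]
      have h1 := ih (d - Finsupp.single i 1) (by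
        rw [Finsupp.sum_fintype _ _ (by simp)]
        have h3 : ∑ j, d j = ∑ j, (d - Finsupp.single i 1 : Fin m →₀ ℕ) j + ∑ j, (Finsupp.single i 1 : Fin m →₀ ℕ) j := by
          rw [← Finset.sum_add_distrib]
          exact Finset.sum_congr rfl fun j _ => DFunLike.congr_fun hd' j
        have h4 : ∑ j, (Finsupp.single i 1 : Fin m →₀ ℕ) j = 1 := by
          simp [Finsupp.single_apply]
        omega)
      have h2 := Dg.mul (LinearMap.proj i) h1
      convert h2 using 2 with x
      conv_lhs => rw [hd']
      simp only [Finsupp.add_apply, pow_add, Finset.prod_mul_distrib]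
      simp only [Finsupp.single_apply, LinearMap.proj_apply, pow_ite, pow_one, pow_zero]
      rw [Finset.prod_ite_eq]
      simp [mul_comm]
  have hsum : ∀ S : Finset (Fin m →₀ ℕ), (∀ d ∈ S, (d.sum fun _ e => e) ≤ r) →
      Dg r (fun x : Fin m → F => ∑ d ∈ S, P.coeff d * ∏ i, x i ^ d i) := by
    intro S
    induction S using Finset.induction_on with
    | empty => intro _; simpa using Dg.const r 0
    | insert a S ha ih =>
      intro h
      simp only [Finset.sum_insert ha]
      exact Dg.add (((hmon _ a rfl).mono (h a (by simp))).cmul _) (ih fun d hd => h d (by simp [hd]))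
  have := hsum P.support (fun d hd => (MvPolynomial.le_totalDegree hd).trans h)
  convert this using 2 with x
  exact MvPolynomial.eval_eq' x P


end Aux

/-- A second weight codeword of `R_q(t(q-1)+s, m)`, `1 ≤ t ≤ m-2`, `2 ≤ s ≤ q-2`,
has its support contained in an affine subspace of codimension `t`. -/
theorem stmt12 {F : Type} [Field F] [Fintype F] [DecidableEq F] {m t s : ℕ}
    (hq : 4 ≤ Fintype.card F) (hm : 3 ≤ m) (ht1 : 1 ≤ t) (ht2 : t ≤ m - 2)
    (hs1 : 2 ≤ s) (hs2 : s ≤ Fintype.card F - 2)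
    (f : (Fin m → F) → F)
    (hf : RM F (t * (Fintype.card F - 1) + s) m f)
    (hw : wt f = (Fintype.card F - 1) * (Fintype.card F - s + 1) *
      Fintype.card F ^ (m - t - 2)) :
    ∃ W : AffineSubspace F (Fin m → F),
      (W : Set (Fin m → F)).Nonempty ∧ Module.finrank F W.direction = m - t ∧
      ∀ x : Fin m → F, f x ≠ 0 → x ∈ W := by
  obtain ⟨P, hP, hPf⟩ := hf
  have hD : Dg (t * (Fintype.card F - 1) + s) f := by
    have h := Dg_of_poly P hP
    have e : (fun x : Fin m → F => MvPolynomial.eval x P) = f := funext hPf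
    rwa [e] at h
  have hN : Nw f = wt f := by
    unfold Nw wt
    rw [Set.ncard_eq_toFinset_card']
    congr 1
    ext x
    simp
  obtain ⟨a, ha⟩ : ∃ a, s = a + 1 := ⟨s - 1, by omega⟩
  obtain ⟨e, he⟩ : ∃ e, Fintype.card F = s + e := ⟨Fintype.card F - s, by omega⟩
  obtain ⟨n, hn⟩ : ∃ n, m = t + 2 + n := ⟨m - t - 2, by omega⟩
  have hpos : 0 < wt f := by
    rw [hw]
    exact Nat.mul_pos (Nat.mul_pos (by omega) (by omega)) (Nat.pow_pos (by omega))
  have hne : ∃ x, f x ≠ 0 := by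
    obtain ⟨x, hx⟩ := Finset.card_pos.1 hpos
    exact ⟨x, (Finset.mem_filter.1 hx).2⟩
  obtain ⟨D, p, hDr, hDp⟩ := final (F := F) rfl (s := s) (e := e) (n := n + 1) he.symm (by omega) (by omega)
    t (Fin m → F) (by rw [Module.finrank_fin_fun]; omega) f hD hne (by
      rw [hN, hw]
      have h1 : m - t - 2 = n := by omega
      have h2 : Fintype.card F - 1 = a + e := by omega
      have h3 : Fintype.card F - s + 1 = e + 1 := by omega
      have h4 : s - 1 = a := by omega
      have h5 : Fintype.card F = a + 1 + e := by omega
      rw [h1, h2, h3, h4, h5]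
      exact le_of_eq (by ring))
  refine ⟨AffineSubspace.mk' p D, ⟨p, AffineSubspace.self_mem_mk' p D⟩, ?_, ?_⟩
  · rw [AffineSubspace.direction_mk', hDr]; omega
  · intro x hx
    rw [AffineSubspace.mem_mk']
    exact hDp x hx
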